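/- Let s ≤ m be positive integers and let A ∈ ℝ^{m×s} be a random matrix whose entries are i.i.d. real Gaussian with mean 0 and variance σ². Then for every g satisfying s/m + 2√(s/m) < g ≤ 1, one has P( max[ σ₁²(A)/(m σ²) − 1 , 1 − σ_s²(A)/(m σ²) ] ≥ g ) ≤ 2 exp( −(m/2) ( √(1+g) − 1 − √(s/m) )² ). -/

import Mathlib

open scoped Matrix

noncomputable section

variable {𝕜 : Type*} [RCLike 𝕜]

/-- The `i`-th largest singular value (1-indexed) of a matrix, via the
Courant–Fischer max–min characterization. -/
def sval {m n : ℕ} (A : Matrix (Fin m) (Fin n) 𝕜) (i : ℕ) : ℝ :=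
  sSup { t : ℝ | 0 ≤ t ∧ ∃ S : Submodule 𝕜 (EuclideanSpace 𝕜 (Fin n)),
    Module.finrank 𝕜 S = i ∧ ∀ x ∈ S, t * ‖x‖ ≤ ‖Matrix.toEuclideanLin A x‖ }

/-- Submatrix of columns indexed by the finset `J` (in increasing order). -/
def colSub {m n : ℕ} (A : Matrix (Fin m) (Fin n) 𝕜) (J : Finset (Fin n)) :
    Matrix (Fin m) (Fin J.card) 𝕜 :=
  A.submatrix id (fun j => J.orderEmbOfFin rfl j)

/-- Submatrix of rows indexed by the finset `J` (in increasing order). -/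
def rowSub {m n : ℕ} (A : Matrix (Fin m) (Fin n) 𝕜) (J : Finset (Fin m)) :
    Matrix (Fin J.card) (Fin n) 𝕜 :=
  A.submatrix (fun i => J.orderEmbOfFin rfl i) id

/-- Moore–Penrose pseudoinverse (valid formula in the full-column-rank case,
which holds in every statement where it is used). -/
def pinv {m n : ℕ} (A : Matrix (Fin m) (Fin n) 𝕜) : Matrix (Fin n) (Fin m) 𝕜 :=
  (Aᴴ * A)⁻¹ * Aᴴ

open Classical in
/-- The set of indices of nonzero rows of a matrix. -/
def rowSupport {n l : ℕ} (X : Matrix (Fin n) (Fin l) 𝕜) : Finset (Fin n) :=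
  Finset.univ.filter (fun i => X i ≠ 0)

/-- Column space (range) of a matrix, as a submodule of Euclidean space. -/
def mrange {m : ℕ} {ι : Type*} [Fintype ι] [DecidableEq ι]
    (A : Matrix (Fin m) ι 𝕜) : Submodule 𝕜 (EuclideanSpace 𝕜 (Fin m)) :=
  LinearMap.range (Matrix.toEuclideanLin A)

/-- Orthogonal projection onto a subspace, as an endomorphism. -/
def proj {m : ℕ} (S : Submodule 𝕜 (EuclideanSpace 𝕜 (Fin m))) :
    EuclideanSpace 𝕜 (Fin m) →L[𝕜] EuclideanSpace 𝕜 (Fin m) :=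
  S.subtypeL.comp (Submodule.orthogonalProjectionOnto S)

/-- The `i`-th column of a matrix, as an element of Euclidean space. -/
def col {m n : ℕ} (A : Matrix (Fin m) (Fin n) 𝕜) (i : Fin n) :
    EuclideanSpace 𝕜 (Fin m) :=
  (WithLp.equiv 2 (Fin m → 𝕜)).symm (fun r => A r i)

/-- The normalized projection `φ̇_i` of the `i`-th column of `Φ` onto the
orthogonal complement of the range of `Φ_Γ` (zero if the projection vanishes). -/
def ndot {m n : ℕ} (Φ : Matrix (Fin m) (Fin n) 𝕜) (Γ : Finset (Fin n)) (i : Fin n) :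
    EuclideanSpace 𝕜 (Fin m) :=
  ‖proj (mrange (colSub Φ Γ))ᗮ (col Φ i)‖⁻¹ • proj (mrange (colSub Φ Γ))ᗮ (col Φ i)

/-- The matrix `Φ̇_J` whose columns are the `φ̇_i`, `i ∈ J`. -/
def ndotMat {m n : ℕ} (Φ : Matrix (Fin m) (Fin n) 𝕜) (Γ J : Finset (Fin n)) :
    Matrix (Fin m) (Fin J.card) 𝕜 :=
  fun r j => ndot Φ Γ (J.orderEmbOfFin rfl j) r

/-- Kruskal rank: the maximal `q` such that every `q` columns are linearly
independent. -/
def krank {ρ ι : Type*} [Fintype ι] (A : Matrix ρ ι 𝕜) : ℕ :=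
  sSup {q : ℕ | q ≤ Fintype.card ι ∧ ∀ J : Finset ι, J.card = q →
    LinearIndependent 𝕜 (fun j : J => Aᵀ j.1)}

/-- `X` is row-nondegenerate if `krank (Xᴴ) = rank X`. -/
def rowNondegenerate {n l : ℕ} (X : Matrix (Fin n) (Fin l) 𝕜) : Prop :=
  krank Xᴴ = X.rank

/-- ℓ₂ norm of the `i`-th row of a matrix. -/
def rowNorm {n l : ℕ} (A : Matrix (Fin n) (Fin l) 𝕜) (i : Fin n) : ℝ :=
  Real.sqrt (∑ j, ‖A i j‖ ^ 2)


open MeasureTheory ProbabilityTheory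


/-- Standard Gaussian measure on `ι → ℝ`. -/
abbrev gpi (ι : Type*) [Fintype ι] : Measure (ι → ℝ) := Measure.pi fun _ : ι => gaussianReal 0 1

/-- Exponentially bounded functions. -/
def EB {ι : Type*} [Fintype ι] (f : (ι → ℝ) → ℝ) : Prop :=
  ∃ C c : ℝ, 0 ≤ C ∧ 0 ≤ c ∧ ∀ w, |f w| ≤ C * Real.exp (c * ∑ k, |w k|)

lemma integrable_exp_abs_gauss (c : ℝ) :
    Integrable (fun x : ℝ => Real.exp (c * |x|)) (gaussianReal 0 1) := by
  have := integrable_exp_mul_abs (X := fun x : ℝ => x) (μ := gaussianReal 0 1) (t := c)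
    (integrable_exp_mul_gaussianReal c) (integrable_exp_mul_gaussianReal (-c))
  exact this

lemma integrable_exp_sum_abs {ι : Type*} [Fintype ι] (c : ℝ) :
    Integrable (fun w : ι → ℝ => Real.exp (c * ∑ k, |w k|)) (gpi ι) := by
  have := Integrable.fintype_prod (ι := ι) (𝕜 := ℝ) (μ := fun _ => gaussianReal 0 1)
    (f := fun _ x => Real.exp (c * |x|)) (fun _ => integrable_exp_abs_gauss c)
  refine this.congr (Filter.Eventually.of_forall fun w => ?_)
  simp only []
  rw [Finset.mul_sum, Real.exp_sum]

lemma EB.integrable {ι : Type*} [Fintype ι] {f : (ι → ℝ) → ℝ} (h : EB f)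
    (hm : Measurable f) : Integrable f (gpi ι) := by
  obtain ⟨C, c, hC, hc, hb⟩ := h
  refine ((integrable_exp_sum_abs (ι := ι) c).const_mul C).mono' hm.aestronglyMeasurable
    (Filter.Eventually.of_forall hb)

lemma EB.mul {ι : Type*} [Fintype ι] {f g : (ι → ℝ) → ℝ} (hf : EB f) (hg : EB g) :
    EB (fun w => f w * g w) := by
  obtain ⟨C, c, hC, hc, hb⟩ := hf
  obtain ⟨D, d, hD, hd, hb'⟩ := hg
  refine ⟨C * D, c + d, by positivity, by positivity, fun w => ?_⟩
  rw [abs_mul, add_mul, Real.exp_add]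
  calc _ ≤ (C * Real.exp (c * ∑ k, |w k|)) * (D * Real.exp (d * ∑ k, |w k|)) := by
        gcongr
        · exact hb w
        · exact hb' w
    _ = _ := by ring

lemma EB.add {ι : Type*} [Fintype ι] {f g : (ι → ℝ) → ℝ} (hf : EB f) (hg : EB g) :
    EB (fun w => f w + g w) := by
  obtain ⟨C, c, hC, hc, hb⟩ := hf
  obtain ⟨D, d, hD, hd, hb'⟩ := hg
  refine ⟨C + D, c + d, by positivity, by positivity, fun w => ?_⟩
  have h0 : 0 ≤ ∑ k, |w k| := Finset.sum_nonneg fun _ _ => abs_nonneg _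
  calc |f w + g w| ≤ |f w| + |g w| := abs_add_le _ _
    _ ≤ C * Real.exp (c * ∑ k, |w k|) + D * Real.exp (d * ∑ k, |w k|) := add_le_add (hb w) (hb' w)
    _ ≤ C * Real.exp ((c + d) * ∑ k, |w k|) + D * Real.exp ((c + d) * ∑ k, |w k|) := by
        gcongr <;> linarith
    _ = _ := by ring

lemma EB.const {ι : Type*} [Fintype ι] (a : ℝ) : EB (fun _ : ι → ℝ => a) :=
  ⟨|a|, 0, abs_nonneg _, le_refl _, fun w => by simp⟩

lemma EB.sum {ι α : Type*} [Fintype ι] (s : Finset α) {f : α → (ι → ℝ) → ℝ}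
    (hf : ∀ a, EB (f a)) : EB (fun w => ∑ a ∈ s, f a w) := by
  classical
  induction s using Finset.induction_on with
  | empty => simpa using EB.const 0
  | insert a s ha ih =>
    simp only [Finset.sum_insert ha]
    exact (hf a).add ih

lemma EB.coord {ι : Type*} [Fintype ι] (k : ι) : EB (fun w : ι → ℝ => w k) := by
  refine ⟨1, 1, by norm_num, by norm_num, fun w => ?_⟩
  have h0 : |w k| ≤ ∑ k, |w k| :=
    Finset.single_le_sum (f := fun k => |w k|) (fun _ _ => abs_nonneg _) (Finset.mem_univ k)
  have := Real.add_one_le_exp (∑ k, |w k|)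
  simp only [one_mul]
  linarith

/-- The Stein identity in one dimension. -/
lemma stein_one (f f' : ℝ → ℝ) (hf : ∀ x, HasDerivAt f (f' x) x)
    (i1 : Integrable (fun x => x * f x) (gaussianReal 0 1))
    (i2 : Integrable f' (gaussianReal 0 1))
    (i3 : Integrable f (gaussianReal 0 1)) :
    ∫ x, x * f x ∂(gaussianReal 0 1) = ∫ x, f' x ∂(gaussianReal 0 1) := by
  have key : ∀ u : ℝ → ℝ, Integrable u (gaussianReal 0 1) →
      Integrable (fun x => u x * gaussianPDFReal 0 1 x) := by
    intro u hu
    rw [gaussianReal_of_var_ne_zero _ one_ne_zero] at hu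
    have := (integrable_withDensity_iff (μ := volume) (measurable_gaussianPDF 0 1)
      (Filter.Eventually.of_forall fun x => ENNReal.ofReal_lt_top)).1 hu
    simpa [gaussianPDF, ENNReal.toReal_ofReal (gaussianPDFReal_nonneg 0 1 _)] using this
  have hv : ∀ x, HasDerivAt (gaussianPDFReal 0 1) (-(x * gaussianPDFReal 0 1 x)) x := by
    intro x
    rw [gaussianPDFReal_def]
    have h1 : HasDerivAt (fun x : ℝ => -(x - 0) ^ 2 / (2 * ((1 : NNReal) : ℝ))) (-x) x := by
      have := (((hasDerivAt_id x).sub_const 0).pow 2).neg.div_const (2 * ((1 : NNReal) : ℝ))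
      exact this.congr_deriv (by simp; ring)
    have := h1.exp.const_mul ((√(2 * Real.pi * ((1 : NNReal) : ℝ)))⁻¹)
    exact this.congr_deriv (by ring)
  rw [integral_gaussianReal_eq_integral_smul one_ne_zero,
    integral_gaussianReal_eq_integral_smul one_ne_zero]
  have := integral_mul_deriv_eq_deriv_mul_of_integrable (u := f) (u' := f')
    (v := gaussianPDFReal 0 1) (v' := fun x => -(x * gaussianPDFReal 0 1 x))
    (fun x _ => hf x) (fun x _ => hv x)
    (by
      refine (key _ i1).neg.congr (Filter.Eventually.of_forall fun x => ?_)
      simp; ring) (key _ i2) (key _ i3)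
  have e1 : ∫ x, f x * -(x * gaussianPDFReal 0 1 x)
      = - ∫ x, gaussianPDFReal 0 1 x • (x * f x) := by
    rw [← integral_neg]; congr 1; ext x; simp; ring
  have e2 : ∫ x, f' x * gaussianPDFReal 0 1 x = ∫ x, gaussianPDFReal 0 1 x • f' x := by
    congr 1; ext x; simp; ring
  rw [e1, e2] at this
  linarith

/-- Resampling one coordinate preserves the product measure. -/
lemma mp_update {ι : Type*} [Fintype ι] [DecidableEq ι] (k : ι) :
    MeasurePreserving (fun p : (ι → ℝ) × ℝ => Function.update p.1 k p.2)
      ((gpi ι).prod (gaussianReal 0 1)) (gpi ι) := by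
  have hm : Measurable (fun p : (ι → ℝ) × ℝ => Function.update p.1 k p.2) := by
    rw [measurable_pi_iff]
    intro i
    by_cases h : i = k
    · subst h; simpa using measurable_snd
    · simp only [Function.update_of_ne h]; fun_prop
  refine ⟨hm, ?_⟩
  symm
  apply Measure.pi_eq
  intro s hs
  rw [Measure.map_apply hm (MeasurableSet.univ_pi hs)]
  have : (fun p : (ι → ℝ) × ℝ => Function.update p.1 k p.2) ⁻¹' (Set.univ.pi s)
      = (Set.univ.pi (Function.update s k Set.univ)) ×ˢ (s k) := by
    ext ⟨w, t⟩
    simp only [Set.mem_preimage, Set.mem_pi, Set.mem_univ, true_imp_iff, Set.mem_prod]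
    constructor
    · intro h
      refine ⟨fun i => ?_, by simpa using h k⟩
      by_cases hi : i = k
      · subst hi; simp
      · simpa [hi] using h i
    · rintro ⟨h1, h2⟩ i
      by_cases hi : i = k
      · subst hi; simpa using h2
      · simpa [hi] using h1 i
  rw [this, Measure.prod_prod, Measure.pi_pi,
    ← Finset.prod_erase_mul _ _ (Finset.mem_univ k), ← Finset.prod_erase_mul Finset.univ (fun i => (gaussianReal 0 1) (s i)) (Finset.mem_univ k)]
  simp only [Function.update_self, measure_univ, mul_one]
  congr 1
  refine Finset.prod_congr rfl fun i hi => ?_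
  rw [Function.update_of_ne (Finset.ne_of_mem_erase hi)]

lemma EB.slice {ι : Type*} [Fintype ι] [DecidableEq ι] {f : (ι → ℝ) → ℝ} (hf : EB f)
    (hm : Measurable f) (w : ι → ℝ) (k : ι) :
    Integrable (fun t => f (Function.update w k t)) (gaussianReal 0 1) := by
  obtain ⟨C, c, hC, hc, hb⟩ := hf
  refine ((integrable_exp_abs_gauss c).const_mul (C * Real.exp (c * ∑ k, |w k|))).mono' 
    (hm.comp (measurable_update w)).aestronglyMeasurable
    (Filter.Eventually.of_forall fun t => ?_)
  refine (hb _).trans ?_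
  rw [mul_assoc, ← Real.exp_add]
  gcongr
  rw [← mul_add]
  gcongr
  rw [← Finset.sum_erase_add _ _ (Finset.mem_univ k)]
  simp only [Function.update_self]
  gcongr
  calc _ = ∑ i ∈ Finset.univ.erase k, |w i| := by
        refine Finset.sum_congr rfl fun i hi => ?_
        rw [Function.update_of_ne (Finset.ne_of_mem_erase hi)]
    _ ≤ _ := Finset.sum_le_sum_of_subset_of_nonneg (Finset.erase_subset _ _)
        fun _ _ _ => abs_nonneg _

/-- The Stein identity for a coordinate of a standard Gaussian vector. -/
lemma stein_multi {ι : Type*} [Fintype ι] [DecidableEq ι] (k : ι) (f f' : (ι → ℝ) → ℝ)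
    (hf : ∀ w t, HasDerivAt (fun x => f (Function.update w k x)) (f' (Function.update w k t)) t)
    (m1 : Measurable f) (m2 : Measurable f') (b1 : EB f) (b2 : EB f') :
    ∫ w, w k * f w ∂(gpi ι) = ∫ w, f' w ∂(gpi ι) := by
  have bk : EB (fun w : ι → ℝ => w k * f w) := (EB.coord k).mul b1
  have mk : Measurable (fun w : ι → ℝ => w k * f w) := (measurable_pi_apply k).mul m1
  have tr : ∀ u : (ι → ℝ) → ℝ, Measurable u → EB u → ∫ w, u w ∂(gpi ι)
      = ∫ w, ∫ t, u (Function.update w k t) ∂(gaussianReal 0 1) ∂(gpi ι) := by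
    intro u mu bu
    have hp := mp_update (ι := ι) k
    conv_lhs => rw [← hp.map_eq]
    rw [integral_map hp.measurable.aemeasurable mu.aestronglyMeasurable, integral_prod]
    exact (hp.integrable_comp mu.aestronglyMeasurable).2 (bu.integrable mu)
  rw [tr _ mk bk, tr _ m2 b2]
  congr 1; ext w
  have := stein_one (fun t => f (Function.update w k t)) (fun t => f' (Function.update w k t))
    (fun t => hf w t) (by simpa using bk.slice mk w k) (b2.slice m2 w k) (b1.slice m1 w k)
  simpa using this

lemma abs_lin_le {I ι : Type*} [Fintype I] [Fintype ι] (a b : I → ι → ℝ) (x y : ℝ)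
    (hx : |x| ≤ 1) (hy : |y| ≤ 1) (w : ι → ℝ) :
    ∑ i, |∑ k, (x * a i k + y * b i k) * w k| ≤ (∑ i, ∑ k, (|a i k| + |b i k|)) * ∑ k, |w k| := by
  rw [Finset.sum_mul]
  refine Finset.sum_le_sum fun i _ => ?_
  refine (Finset.abs_sum_le_sum_abs _ _).trans ?_
  rw [Finset.sum_mul]
  refine Finset.sum_le_sum fun k _ => ?_
  rw [abs_mul]
  gcongr
  · refine (abs_add_le _ _).trans ?_
    rw [abs_mul, abs_mul]
    nlinarith [abs_nonneg (a i k), abs_nonneg (b i k)]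
  · exact Finset.single_le_sum (f := fun k => |w k|) (fun _ _ => abs_nonneg _) (Finset.mem_univ k)

lemma EB.comp_lin {I ι : Type*} [Fintype I] [Fintype ι] {F : (I → ℝ) → ℝ} (hF : EB F)
    (a b : I → ι → ℝ) : ∃ C c : ℝ, 0 ≤ C ∧ 0 ≤ c ∧ ∀ x y : ℝ, |x| ≤ 1 → |y| ≤ 1 → ∀ w : ι → ℝ,
      |F (fun i => ∑ k, (x * a i k + y * b i k) * w k)| ≤ C * Real.exp (c * ∑ k, |w k|) := by
  obtain ⟨C, c, hC, hc, hb⟩ := hF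
  refine ⟨C, c * (∑ i, ∑ k, (|a i k| + |b i k|)), hC, by positivity, fun x y hx hy w => ?_⟩
  refine (hb _).trans ?_
  rw [mul_assoc]
  gcongr
  exact abs_lin_le a b x y hx hy w

/-- Gaussian interpolation (Kahane-type comparison). -/
theorem gauss_compare {I ι : Type*} [Fintype I] [Fintype ι] [DecidableEq ι]
    (a b : I → ι → ℝ) (Φ : (I → ℝ) → ℝ) (D1 : I → (I → ℝ) → ℝ) (D2 : I → I → (I → ℝ) → ℝ)
    (hΦ : ∀ (z : ℝ → I → ℝ) (z' : I → ℝ) (t : ℝ), (∀ i, HasDerivAt (fun s => z s i) (z' i) t) →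
      HasDerivAt (fun s => Φ (z s)) (∑ i, D1 i (z t) * z' i) t)
    (hD1 : ∀ i, ∀ (z : ℝ → I → ℝ) (z' : I → ℝ) (t : ℝ),
      (∀ i, HasDerivAt (fun s => z s i) (z' i) t) →
      HasDerivAt (fun s => D1 i (z s)) (∑ j, D2 i j (z t) * z' j) t)
    (c0 : Continuous Φ) (c1 : ∀ i, Continuous (D1 i)) (c2 : ∀ i j, Continuous (D2 i j))
    (e0 : EB Φ) (e1 : ∀ i, EB (D1 i)) (e2 : ∀ i j, EB (D2 i j))
    (hab : ∀ i j, ∑ k, a i k * b j k = 0)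
    (hsgn : ∀ i j z, 0 ≤ D2 i j z * (∑ k, b i k * b j k - ∑ k, a i k * a j k)) :
    ∫ w, Φ (fun i => ∑ k, a i k * w k) ∂(gpi ι) ≤ ∫ w, Φ (fun i => ∑ k, b i k * w k) ∂(gpi ι) := by
  set Z : ℝ → (ι → ℝ) → I → ℝ := fun θ w i =>
    ∑ k, (Real.cos θ * a i k + Real.sin θ * b i k) * w k with hZ
  have cZ : ∀ θ, Continuous (Z θ) := fun θ => by
    simp only [hZ]; fun_prop
  have bZ : ∀ {F : (I → ℝ) → ℝ}, EB F → ∀ θ, EB (fun w => F (Z θ w)) := by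
    intro F hF θ
    obtain ⟨C, c, hC, hc, h⟩ := hF.comp_lin a b
    exact ⟨C, c, hC, hc, fun w => h _ _ (Real.abs_cos_le_one θ) (Real.abs_sin_le_one θ) w⟩
  set Zd : ℝ → (ι → ℝ) → I → ℝ := fun θ w i =>
    ∑ k, (-Real.sin θ * a i k + Real.cos θ * b i k) * w k with hZd
  -- derivative of φ
  have hder : ∀ θ, HasDerivAt (fun θ => ∫ w, Φ (Z θ w) ∂(gpi ι))
      (∫ w, ∑ i, D1 i (Z θ w) * Zd θ w i ∂(gpi ι)) θ := by
    intro θ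
    choose C c hC hc hb using fun i => (e1 i).comp_lin a b
    set M := ∑ i, ∑ k, (|a i k| + |b i k|)
    have hM : 0 ≤ M := by positivity
    refine (hasDerivAt_integral_of_dominated_loc_of_deriv_le (s := Set.univ)
      (bound := fun w => ∑ i, (C i * Real.exp (c i * ∑ k, |w k|)) * (M * Real.exp (1 * ∑ k, |w k|)))
      (F' := fun θ w => ∑ i, D1 i (Z θ w) * Zd θ w i)
      Filter.univ_mem ?_ ?_ ?_ ?_ ?_ ?_).2
    · exact Filter.Eventually.of_forall fun θ => (c0.comp (cZ θ)).aestronglyMeasurable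
    · exact (bZ e0 θ).integrable (c0.comp (cZ θ)).measurable
    · refine Continuous.aestronglyMeasurable ?_
      refine continuous_finsetSum _ fun i _ => ?_
      refine ((c1 i).comp (cZ θ)).mul ?_
      simp only [hZd]; fun_prop
    · refine Filter.Eventually.of_forall fun w θ _ => ?_
      rw [Real.norm_eq_abs]
      refine (Finset.abs_sum_le_sum_abs _ _).trans (Finset.sum_le_sum fun i _ => ?_)
      rw [abs_mul]
      refine mul_le_mul (hb i _ _ (Real.abs_cos_le_one θ) (Real.abs_sin_le_one θ) w) ?_
        (abs_nonneg _) (mul_nonneg (hC i) (Real.exp_nonneg _))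
      have h1 := abs_lin_le a b (-Real.sin θ) (Real.cos θ)
        (by rw [abs_neg]; exact Real.abs_sin_le_one θ) (Real.abs_cos_le_one θ) w
      have h2 : |Zd θ w i| ≤ ∑ i, |Zd θ w i| :=
        Finset.single_le_sum (f := fun i => |Zd θ w i|) (fun _ _ => abs_nonneg _) (Finset.mem_univ i)
      refine (h2.trans h1).trans ?_
      gcongr
      have := Real.add_one_le_exp (∑ k, |w k|)
      simp only [one_mul]
      linarith
    · refine integrable_finsetSum _ fun i _ => ?_
      have := (integrable_exp_sum_abs (ι := ι) (c i + 1)).const_mul (C i * M)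
      refine this.congr (Filter.Eventually.of_forall fun w => ?_)
      simp only [add_mul, Real.exp_add]
      ring
    · refine Filter.Eventually.of_forall fun w θ _ => ?_
      refine hΦ (fun θ => Z θ w) (Zd θ w) θ fun i => ?_
      simp only [hZ, hZd]
      refine HasDerivAt.fun_sum fun k _ => ?_
      exact (((Real.hasDerivAt_cos θ).mul_const _).add
        ((Real.hasDerivAt_sin θ).mul_const _)).mul_const _
  have hval : ∀ θ, ∫ w, ∑ i, D1 i (Z θ w) * Zd θ w i ∂(gpi ι)
      = ∑ i, ∑ j, (∫ w, D2 i j (Z θ w) ∂(gpi ι)) *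
        ((Real.sin θ * Real.cos θ) * (∑ k, b i k * b j k - ∑ k, a i k * a j k)) := by
    intro θ
    have st : ∀ i k, ∫ w, w k * D1 i (Z θ w) ∂(gpi ι)
        = ∑ j, (∫ w, D2 i j (Z θ w) ∂(gpi ι)) * (Real.cos θ * a j k + Real.sin θ * b j k) := by
      intro i k
      rw [stein_multi k (fun w => D1 i (Z θ w))
        (fun w => ∑ j, D2 i j (Z θ w) * (Real.cos θ * a j k + Real.sin θ * b j k))]
      · rw [integral_finsetSum _ fun j _ =>
          (((bZ (e2 i j) θ).integrable ((c2 i j).comp (cZ θ)).measurable).mul_const _)]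
        simp only [integral_mul_const]
      · intro w t
        refine hD1 i (fun x => Z θ (Function.update w k x)) _ t fun j => ?_
        simp only [hZ]
        have : ∀ x, (∑ l, (Real.cos θ * a j l + Real.sin θ * b j l) * Function.update w k x l)
            = (Real.cos θ * a j k + Real.sin θ * b j k) * x +
              ∑ l ∈ Finset.univ.erase k, (Real.cos θ * a j l + Real.sin θ * b j l) * w l := by
          intro x
          rw [← Finset.add_sum_erase _ _ (Finset.mem_univ k)]
          simp only [Function.update_self]
          congr 1
          refine Finset.sum_congr rfl fun l hl => ?_
          rw [Function.update_of_ne (Finset.ne_of_mem_erase hl)]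
        simp only [this]
        exact (((hasDerivAt_id t).const_mul _).add_const _).congr_deriv (by simp)
      · exact ((c1 i).comp (cZ θ)).measurable
      · exact (continuous_finsetSum _ fun j _ =>
          ((c2 i j).comp (cZ θ)).mul continuous_const).measurable
      · exact bZ (e1 i) θ
      · exact EB.sum _ fun j => (bZ (e2 i j) θ).mul (EB.const _)
    have i1 : ∀ i k, Integrable (fun w => w k * D1 i (Z θ w)) (gpi ι) := fun i k =>
      ((EB.coord k).mul (bZ (e1 i) θ)).integrable
        ((measurable_pi_apply k).mul ((c1 i).comp (cZ θ)).measurable)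
    have r : ∀ w, ∑ i, D1 i (Z θ w) * Zd θ w i = ∑ i, ∑ k,
        (w k * D1 i (Z θ w)) * (-Real.sin θ * a i k + Real.cos θ * b i k) := by
      intro w
      refine Finset.sum_congr rfl fun i _ => ?_
      simp only [hZd]
      rw [Finset.mul_sum]
      refine Finset.sum_congr rfl fun k _ => by ring
    simp only [r]
    rw [integral_finsetSum _ fun i _ => integrable_finsetSum _ fun k _ => (i1 i k).mul_const _]
    refine Finset.sum_congr rfl fun i _ => ?_
    rw [integral_finsetSum _ fun k _ => (i1 i k).mul_const _]
    simp only [integral_mul_const, st, Finset.sum_mul]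
    rw [Finset.sum_comm]
    refine Finset.sum_congr rfl fun j _ => ?_
    simp only [mul_assoc]
    rw [← Finset.mul_sum]
    congr 1
    have h1 := hab i j
    have h2 := hab j i
    have : ∀ k, (Real.cos θ * a j k + Real.sin θ * b j k) * (-Real.sin θ * a i k + Real.cos θ * b i k)
      = (Real.sin θ * Real.cos θ) * (b i k * b j k) - (Real.sin θ * Real.cos θ) * (a i k * a j k)
        - Real.sin θ ^ 2 * (a i k * b j k) + Real.cos θ ^ 2 * (a j k * b i k) := fun k => by ring
    simp only [this, Finset.sum_add_distrib, Finset.sum_sub_distrib, ← Finset.mul_sum, h1, h2]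
    ring
  have mono : MonotoneOn (fun θ => ∫ w, Φ (Z θ w) ∂(gpi ι)) (Set.Icc 0 (Real.pi / 2)) := by
    refine monotoneOn_of_deriv_nonneg (convex_Icc _ _)
      (fun θ _ => (hder θ).continuousAt.continuousWithinAt)
      (fun θ _ => (hder θ).differentiableAt.differentiableWithinAt) fun θ hθ => ?_
    rw [interior_Icc] at hθ
    rw [(hder θ).deriv, hval θ]
    refine Finset.sum_nonneg fun i _ => Finset.sum_nonneg fun j _ => ?_
    have hs : 0 ≤ Real.sin θ := Real.sin_nonneg_of_nonneg_of_le_pi hθ.1.le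
      (by linarith [hθ.2, Real.pi_pos])
    have hc : 0 ≤ Real.cos θ := Real.cos_nonneg_of_neg_pi_div_two_le_of_le
      (by linarith [hθ.1, Real.pi_pos]) hθ.2.le
    have : 0 ≤ (∫ w, D2 i j (Z θ w) ∂(gpi ι)) * (∑ k, b i k * b j k - ∑ k, a i k * a j k) := by
      rw [← integral_mul_const]
      exact integral_nonneg fun w => hsgn i j _
    calc (0:ℝ) ≤ (Real.sin θ * Real.cos θ) * _ := mul_nonneg (mul_nonneg hs hc) this
      _ = _ := by ring
  have hp : (0:ℝ) ≤ Real.pi / 2 := by positivity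
  have := mono (Set.left_mem_Icc.2 hp) (Set.right_mem_Icc.2 hp) hp
  simpa [hZ] using this

/-- Positive functions with exponential upper and lower bounds. -/
def LB {ι : Type*} [Fintype ι] (f : (ι → ℝ) → ℝ) : Prop :=
  ∃ C c : ℝ, 0 ≤ C ∧ 0 ≤ c ∧ ∀ w, Real.exp (-(C + c * ∑ k, |w k|)) ≤ f w ∧
    f w ≤ Real.exp (C + c * ∑ k, |w k|)

lemma LB.eb {ι : Type*} [Fintype ι] {f : (ι → ℝ) → ℝ} (h : LB f) : EB f := by
  obtain ⟨C, c, hC, hc, hb⟩ := h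
  refine ⟨Real.exp C, c, (Real.exp_pos _).le, hc, fun w => ?_⟩
  rw [abs_of_pos ((Real.exp_pos _).trans_le (hb w).1), ← Real.exp_add]
  exact (hb w).2

lemma LB.rpow {ι : Type*} [Fintype ι] {f : (ι → ℝ) → ℝ} (h : LB f) (r : ℝ) :
    LB (fun w => f w ^ r) := by
  obtain ⟨C, c, hC, hc, hb⟩ := h
  refine ⟨|r| * C, |r| * c, by positivity, by positivity, fun w => ?_⟩
  have hp : 0 < f w := (Real.exp_pos _).trans_le (hb w).1
  have h1 : |Real.log (f w)| ≤ C + c * ∑ k, |w k| := by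
    rw [abs_le]
    exact ⟨(Real.le_log_iff_exp_le hp).2 (hb w).1, (Real.log_le_iff_le_exp hp).2 (hb w).2⟩
  have h2 : |Real.log (f w) * r| ≤ |r| * C + |r| * c * ∑ k, |w k| := by
    rw [abs_mul]
    calc _ ≤ (C + c * ∑ k, |w k|) * |r| := by gcongr
      _ = _ := by ring
  rw [abs_le] at h2
  simp only []
  rw [Real.rpow_def_of_pos hp, Real.exp_le_exp, Real.exp_le_exp]
  exact h2

lemma LB.sum {ι α : Type*} [Fintype ι] [Fintype α] [Nonempty α] {f : α → (ι → ℝ) → ℝ}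
    (hf : ∀ a, LB (f a)) : LB (fun w => ∑ a, f a w) := by
  choose C c hC hc hb using hf
  refine ⟨Fintype.card α + ∑ a, C a, ∑ a, c a, ?_, Finset.sum_nonneg fun a _ => hc a, fun w => ?_⟩
  · exact add_nonneg (Nat.cast_nonneg _) (Finset.sum_nonneg fun a _ => hC a)
  have hN : 0 ≤ ∑ k, |w k| := Finset.sum_nonneg fun _ _ => abs_nonneg _
  have key : ∀ a, C a + c a * ∑ k, |w k| ≤ ∑ a, C a + (∑ a, c a) * ∑ k, |w k| := fun a => by
    have h1 : C a ≤ ∑ a, C a := Finset.single_le_sum (fun a _ => hC a) (Finset.mem_univ a)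
    have h2 : c a ≤ ∑ a, c a := Finset.single_le_sum (fun a _ => hc a) (Finset.mem_univ a)
    gcongr
  have hpos : ∀ a, 0 ≤ f a w := fun a => (Real.exp_pos _).le.trans (hb a w).1
  constructor
  · obtain ⟨a⟩ := ‹Nonempty α›
    calc _ ≤ Real.exp (-(C a + c a * ∑ k, |w k|)) := by
          rw [Real.exp_le_exp]
          have := key a
          have : (0:ℝ) ≤ Fintype.card α := Nat.cast_nonneg _
          linarith
      _ ≤ f a w := (hb a w).1
      _ ≤ _ := Finset.single_le_sum (f := fun a => f a w) (fun a _ => hpos a) (Finset.mem_univ a)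
  · calc _ ≤ ∑ a : α, Real.exp (∑ a, C a + (∑ a, c a) * ∑ k, |w k|) :=
          Finset.sum_le_sum fun a _ => (hb a w).2.trans (Real.exp_le_exp.2 (key a))
      _ = Fintype.card α * Real.exp (∑ a, C a + (∑ a, c a) * ∑ k, |w k|) := by simp
      _ ≤ Real.exp (Fintype.card α) * Real.exp (∑ a, C a + (∑ a, c a) * ∑ k, |w k|) := by
          gcongr
          linarith [Real.add_one_le_exp (Fintype.card α : ℝ)]
      _ = _ := by rw [← Real.exp_add]; congr 1; ring

lemma LB.exp_coord {ι : Type*} [Fintype ι] (β : ℝ) (i : ι) :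
    LB (fun w : ι → ℝ => Real.exp (β * w i)) := by
  refine ⟨0, |β|, le_refl _, abs_nonneg _, fun w => ?_⟩
  have h0 : |w i| ≤ ∑ k, |w k| :=
    Finset.single_le_sum (f := fun k => |w k|) (fun _ _ => abs_nonneg _) (Finset.mem_univ i)
  have h2 : |β * w i| ≤ |β| * ∑ k, |w k| := by
    rw [abs_mul]; gcongr
  rw [abs_le] at h2
  rw [Real.exp_le_exp, Real.exp_le_exp]
  constructor <;> linarith [h2.1, h2.2]

set_option linter.unusedSectionVars false
section soft
variable {U V : Type*} [Fintype U] [Fintype V] [Nonempty U] [Nonempty V]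
  [DecidableEq U] [DecidableEq V]

def sT (β : ℝ) (u : U) (z : U × V → ℝ) : ℝ := ∑ v, Real.exp (β * z (u, v))
def sS (β p : ℝ) (z : U × V → ℝ) : ℝ := ∑ u, sT β u z ^ p
def sPhi (β p κ : ℝ) (z : U × V → ℝ) : ℝ := sS β p z ^ κ
def sD1 (β p κ : ℝ) (i : U × V) (z : U × V → ℝ) : ℝ :=
  (κ * (p * β)) * (sS β p z ^ (κ - 1) * (sT β i.1 z ^ (p - 1) * Real.exp (β * z i)))
def sD2 (β p κ : ℝ) (i j : U × V) (z : U × V → ℝ) : ℝ :=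
  (κ * (κ - 1) * (p * β) ^ 2) * (sS β p z ^ (κ - 1 - 1) *
    (sT β j.1 z ^ (p - 1) * (Real.exp (β * z j) * (sT β i.1 z ^ (p - 1) * Real.exp (β * z i)))))
  + (if i.1 = j.1 then κ * p * (p - 1) * β ^ 2 else 0) * (sS β p z ^ (κ - 1) *
      (sT β i.1 z ^ (p - 1 - 1) * (Real.exp (β * z j) * Real.exp (β * z i))))
  + (if i = j then κ * p * β ^ 2 else 0) * (sS β p z ^ (κ - 1) *
      (sT β i.1 z ^ (p - 1) * Real.exp (β * z i)))

lemma sT_pos (β : ℝ) (u : U) (z : U × V → ℝ) : 0 < sT β u z :=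
  Finset.sum_pos (fun _ _ => Real.exp_pos _) Finset.univ_nonempty

lemma sS_pos (β p : ℝ) (z : U × V → ℝ) : 0 < sS β p z :=
  Finset.sum_pos (fun _ _ => Real.rpow_pos_of_pos (sT_pos _ _ _) _) Finset.univ_nonempty

lemma sT_lb (β : ℝ) (u : U) : LB (sT β u : (U × V → ℝ) → ℝ) :=
  LB.sum fun _ => LB.exp_coord _ _

lemma sS_lb (β p : ℝ) : LB (sS β p : (U × V → ℝ) → ℝ) :=
  LB.sum fun _ => (sT_lb _ _).rpow _

lemma sT_cont (β : ℝ) (u : U) : Continuous (sT β u : (U × V → ℝ) → ℝ) := by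
  unfold sT; fun_prop

lemma sS_cont (β p : ℝ) : Continuous (sS β p : (U × V → ℝ) → ℝ) :=
  continuous_finsetSum _ fun u _ => (sT_cont β u).rpow_const fun z => Or.inl (sT_pos β u z).ne'

lemma sT_deriv (β : ℝ) (u : U) (z : ℝ → U × V → ℝ) (z' : U × V → ℝ) (t : ℝ)
    (hz : ∀ i, HasDerivAt (fun s => z s i) (z' i) t) :
    HasDerivAt (fun s => sT β u (z s)) (∑ v, Real.exp (β * z t (u, v)) * (β * z' (u, v))) t :=
  HasDerivAt.fun_sum fun v _ => ((hz (u, v)).const_mul β).exp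

lemma sS_deriv (β p : ℝ) (z : ℝ → U × V → ℝ) (z' : U × V → ℝ) (t : ℝ)
    (hz : ∀ i, HasDerivAt (fun s => z s i) (z' i) t) :
    HasDerivAt (fun s => sS β p (z s))
      (∑ u, (∑ v, Real.exp (β * z t (u, v)) * (β * z' (u, v))) * p * sT β u (z t) ^ (p - 1)) t :=
  HasDerivAt.fun_sum fun u _ => (sT_deriv β u z z' t hz).rpow_const (Or.inl (sT_pos β u (z t)).ne')

lemma sPhi_deriv (β p κ : ℝ) (z : ℝ → U × V → ℝ) (z' : U × V → ℝ) (t : ℝ)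
    (hz : ∀ i, HasDerivAt (fun s => z s i) (z' i) t) :
    HasDerivAt (fun s => sPhi β p κ (z s)) (∑ i, sD1 β p κ i (z t) * z' i) t := by
  have := (sS_deriv β p z z' t hz).rpow_const (p := κ) (Or.inl (sS_pos β p (z t)).ne')
  refine this.congr_deriv ?_
  rw [Fintype.sum_prod_type]
  simp only [sD1, Finset.sum_mul]
  refine Finset.sum_congr rfl fun u _ => Finset.sum_congr rfl fun v _ => by ring

lemma sD1_deriv (β p κ : ℝ) (i : U × V) (z : ℝ → U × V → ℝ) (z' : U × V → ℝ) (t : ℝ)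
    (hz : ∀ i, HasDerivAt (fun s => z s i) (z' i) t) :
    HasDerivAt (fun s => sD1 β p κ i (z s)) (∑ j, sD2 β p κ i j (z t) * z' j) t := by
  have h1 := (sS_deriv β p z z' t hz).rpow_const (p := κ - 1) (Or.inl (sS_pos β p (z t)).ne')
  have h2 := (sT_deriv β i.1 z z' t hz).rpow_const (p := p - 1)
    (Or.inl (sT_pos β i.1 (z t)).ne')
  have h3 := ((hz i).const_mul β).exp
  refine ((h1.mul (h2.mul h3)).const_mul (κ * (p * β))).congr_deriv ?_
  simp only [sD2, add_mul, Finset.sum_add_distrib]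
  have e3 : ∑ j : U × V, ((if i = j then κ * p * β ^ 2 else 0) * (sS β p (z t) ^ (κ - 1) *
      (sT β i.1 (z t) ^ (p - 1) * Real.exp (β * z t i)))) * z' j
      = κ * p * β ^ 2 * (sS β p (z t) ^ (κ - 1) *
      (sT β i.1 (z t) ^ (p - 1) * Real.exp (β * z t i))) * z' i := by
    rw [Finset.sum_eq_single i]
    · simp
    · intro j _ hj; simp [Ne.symm hj]
    · simp
  have e2 : ∑ j : U × V, ((if i.1 = j.1 then κ * p * (p - 1) * β ^ 2 else 0) * (sS β p (z t) ^ (κ - 1) *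
      (sT β i.1 (z t) ^ (p - 1 - 1) * (Real.exp (β * z t j) * Real.exp (β * z t i))))) * z' j
      = ∑ v, (κ * p * (p - 1) * β ^ 2 * (sS β p (z t) ^ (κ - 1) *
      (sT β i.1 (z t) ^ (p - 1 - 1) * (Real.exp (β * z t (i.1, v)) * Real.exp (β * z t i))))) * z' (i.1, v) := by
    rw [Fintype.sum_prod_type, Finset.sum_eq_single i.1]
    · simp
    · intro j _ hj; simp [Ne.symm hj]
    · simp
  rw [e2, e3]
  rw [Fintype.sum_prod_type]
  simp only [Finset.sum_mul, mul_add, Finset.mul_sum, Pi.mul_apply]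
  rw [← add_assoc]
  congr 1
  · congr 1
    · refine Finset.sum_congr rfl fun u _ => Finset.sum_congr rfl fun v _ => by ring
    · refine Finset.sum_congr rfl fun v _ => by ring
  · ring

lemma soft_compare {ι : Type*} [Fintype ι] [DecidableEq ι]
    (a b : U × V → ι → ℝ) (β p κ : ℝ) (hκ : 0 < κ) (hκ1 : κ ≤ 1)
    (hab : ∀ i j, ∑ k, a i k * b j k = 0)
    (h0 : ∀ u v v', ∑ k, a (u, v) k * a (u, v') k = ∑ k, b (u, v) k * b (u, v') k)
    (h1 : ∀ i j, ∑ k, b i k * b j k ≤ ∑ k, a i k * a j k) :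
    ∫ w, sPhi β p κ (fun i => ∑ k, a i k * w k) ∂(gpi ι)
      ≤ ∫ w, sPhi β p κ (fun i => ∑ k, b i k * w k) ∂(gpi ι) := by
  have cS : ∀ r : ℝ, Continuous fun z : U × V → ℝ => sS β p z ^ r := fun r =>
    (sS_cont β p).rpow_const fun z => Or.inl (sS_pos β p z).ne'
  have cT : ∀ (u : U) (r : ℝ), Continuous fun z : U × V → ℝ => sT β u z ^ r := fun u r =>
    (sT_cont β u).rpow_const fun z => Or.inl (sT_pos β u z).ne'
  have cE : ∀ i, Continuous fun z : U × V → ℝ => Real.exp (β * z i) := fun i => by fun_prop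
  have bS : ∀ r : ℝ, EB fun z : U × V → ℝ => sS β p z ^ r := fun r => ((sS_lb β p).rpow r).eb
  have bT : ∀ (u : U) (r : ℝ), EB fun z : U × V → ℝ => sT β u z ^ r := fun u r => ((sT_lb β u).rpow r).eb
  have bE : ∀ i, EB fun z : U × V → ℝ => Real.exp (β * z i) := fun i => (LB.exp_coord β i).eb
  refine gauss_compare a b (sPhi β p κ) (sD1 β p κ) (sD2 β p κ) (sPhi_deriv β p κ)
    (sD1_deriv β p κ) (cS κ) (fun i => ?_) (fun i j => ?_) (bS κ) (fun i => ?_) (fun i j => ?_)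
    hab fun i j z => ?_
  · exact continuous_const.mul ((cS _).mul ((cT _ _).mul (cE _)))
  · exact ((continuous_const.mul ((cS _).mul ((cT _ _).mul ((cE _).mul ((cT _ _).mul (cE _)))))).add
      (continuous_const.mul ((cS _).mul ((cT _ _).mul ((cE _).mul (cE _)))))).add
      (continuous_const.mul ((cS _).mul ((cT _ _).mul (cE _))))
  · exact (EB.const _).mul ((bS _).mul ((bT _ _).mul (bE _)))
  · exact (((EB.const _).mul ((bS _).mul ((bT _ _).mul ((bE _).mul ((bT _ _).mul (bE _)))))).add
      ((EB.const _).mul ((bS _).mul ((bT _ _).mul ((bE _).mul (bE _)))))).add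
      ((EB.const _).mul ((bS _).mul ((bT _ _).mul (bE _))))
  · obtain ⟨u, v⟩ := i
    obtain ⟨u', v'⟩ := j
    by_cases h : u = u'
    · subst h
      rw [h0 u v v', sub_self, mul_zero]
    · refine mul_nonneg_of_nonpos_of_nonpos ?_ (by linarith [h1 (u, v) (u', v')])
      simp only [sD2, Prod.mk.injEq, h, if_false, false_and, zero_mul, add_zero]
      refine mul_nonpos_of_nonpos_of_nonneg ?_ ?_
      · nlinarith [sq_nonneg (p * β), mul_nonneg hκ.le (sub_nonneg.2 hκ1)]
      · have := sS_pos β p z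
        have := sT_pos β u z
        have := sT_pos β u' z
        positivity
end soft

lemma gpi_sum_mul {α β : Type*} [Fintype α] [Fintype β] (f : (α → ℝ) → ℝ) (g : (β → ℝ) → ℝ) :
    ∫ w, f (fun i => w (Sum.inl i)) * g (fun i => w (Sum.inr i)) ∂(gpi (α ⊕ β))
      = (∫ w, f w ∂(gpi α)) * ∫ w, g w ∂(gpi β) := by
  have h := measurePreserving_sumPiEquivProdPi (ι := α) (ι' := β) (X := fun _ => ℝ)
    (fun _ => gaussianReal 0 1)
  have := h.integral_comp' (g := fun q => f q.1 * g q.2)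
  rw [← integral_prod_mul]
  exact this

lemma gpi_sum_mul2 {α β γ δ : Type*} [Fintype α] [Fintype β] [Fintype γ] [Fintype δ]
    (f : (α → ℝ) → ℝ) (g : (β → ℝ) → ℝ) (h : (γ → ℝ) → ℝ) (k : (δ → ℝ) → ℝ) :
    ∫ w, (f (fun i => w (Sum.inl (Sum.inl i))) * g (fun i => w (Sum.inl (Sum.inr i)))) *
      (h (fun i => w (Sum.inr (Sum.inl i))) * k (fun i => w (Sum.inr (Sum.inr i))))
      ∂(gpi ((α ⊕ β) ⊕ (γ ⊕ δ)))
      = ((∫ w, f w ∂(gpi α)) * ∫ w, g w ∂(gpi β)) *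
        ((∫ w, h w ∂(gpi γ)) * ∫ w, k w ∂(gpi δ)) := by
  rw [← gpi_sum_mul, ← gpi_sum_mul, ← gpi_sum_mul]

lemma gpi_unit_exp (l : ℝ) : ∫ w : Unit → ℝ, Real.exp (l * w ()) ∂(gpi Unit)
    = Real.exp (l ^ 2 / 2) := by
  have := integral_comp_eval (ι := Unit) (X := fun _ => ℝ) (μ := fun _ => gaussianReal 0 1)
    (i := ()) (f := fun x : ℝ => Real.exp (l * x)) (by fun_prop)
  rw [this]
  have h := mgf_gaussianReal (p := gaussianReal 0 1) (X := fun x : ℝ => x) (μ := 0) (v := 1)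
    (by simp) l
  simp only [mgf] at h
  rw [h]; simp

section chevet
variable {U V M N : Type*} [Fintype U] [Fintype V] [Nonempty U] [Nonempty V]
  [DecidableEq U] [DecidableEq V] [Fintype M] [Fintype N] [DecidableEq M] [DecidableEq N]

lemma sPhi_shift (β p κ c : ℝ) (z : U × V → ℝ) :
    sPhi β p κ (fun i => z i + c) = Real.exp ((κ * β * p) * c) * sPhi β p κ z := by
  have hT : ∀ u, sT β u (fun i => z i + c) = Real.exp (β * c) * sT β u z := by
    intro u
    simp only [sT, mul_add, Real.exp_add, Finset.mul_sum]
    exact Finset.sum_congr rfl fun v _ => by ring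
  have hS : sS β p (fun i => z i + c) = Real.exp (β * c * p) * sS β p z := by
    simp only [sS, hT, Finset.mul_sum]
    refine Finset.sum_congr rfl fun u _ => ?_
    rw [Real.mul_rpow (Real.exp_pos _).le (sT_pos _ _ _).le, ← Real.exp_mul]
  rw [sPhi, hS, Real.mul_rpow (Real.exp_pos _).le (sS_pos _ _ _).le, ← Real.exp_mul, sPhi]
  congr 2; ring

lemma sPhi_split (β p κ : ℝ) (f : U → ℝ) (g : V → ℝ) :
    sPhi β p κ (fun i : U × V => f i.1 + g i.2)
      = (∑ u, Real.exp (β * p * f u)) ^ κ * (∑ v, Real.exp (β * g v)) ^ (p * κ) := by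
  have hG : 0 < ∑ v, Real.exp (β * g v) :=
    Finset.sum_pos (fun _ _ => Real.exp_pos _) Finset.univ_nonempty
  have hT : ∀ u, sT β u (fun i : U × V => f i.1 + g i.2)
      = Real.exp (β * f u) * ∑ v, Real.exp (β * g v) := by
    intro u
    simp only [sT, mul_add, Real.exp_add, Finset.mul_sum]
  have hS : sS β p (fun i : U × V => f i.1 + g i.2)
      = (∑ u, Real.exp (β * p * f u)) * (∑ v, Real.exp (β * g v)) ^ p := by
    simp only [sS, hT, Finset.sum_mul]
    refine Finset.sum_congr rfl fun u _ => ?_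
    rw [Real.mul_rpow (Real.exp_pos _).le hG.le, ← Real.exp_mul]
    congr 2; ring
  rw [sPhi, hS, Real.mul_rpow (Finset.sum_nonneg fun _ _ => (Real.exp_pos _).le)
    (Real.rpow_nonneg hG.le _), ← Real.rpow_mul hG.le]

theorem chevet_gordon (x : U → N → ℝ) (y : V → M → ℝ) (hx : ∀ u, ∑ j, x u j ^ 2 = 1)
    (hy : ∀ v, ∑ i, y v i ^ 2 = 1) (β p κ : ℝ) (hκ : 0 < κ) (hκ1 : κ ≤ 1) :
    Real.exp ((κ * β * p) ^ 2 / 2) *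
      ∫ A : M × N → ℝ, sPhi β p κ (fun q : U × V => ∑ k : M × N, (y q.2 k.1 * x q.1 k.2) * A k)
        ∂(gpi (M × N))
    ≤ (∫ g : N → ℝ, (∑ u, Real.exp (β * p * ∑ j, x u j * g j)) ^ κ ∂(gpi N)) *
      ∫ h : M → ℝ, (∑ v, Real.exp (β * ∑ i, y v i * h i)) ^ (p * κ) ∂(gpi M) := by
  set a : U × V → (((M × N) ⊕ Unit) ⊕ (N ⊕ M)) → ℝ := fun q =>
    Sum.elim (Sum.elim (fun k => y q.2 k.1 * x q.1 k.2) (fun _ => 1)) (fun _ => 0) with ha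
  set b : U × V → (((M × N) ⊕ Unit) ⊕ (N ⊕ M)) → ℝ := fun q =>
    Sum.elim (fun _ => 0) (Sum.elim (x q.1) (y q.2)) with hb
  have haa : ∀ q q', ∑ k, a q k * a q' k
      = (∑ i, y q.2 i * y q'.2 i) * (∑ j, x q.1 j * x q'.1 j) + 1 := by
    intro q q'
    simp only [ha, Fintype.sum_sum_type, Sum.elim_inl, Sum.elim_inr, Fintype.sum_prod_type,
      Finset.sum_mul_sum]
    simp
    refine Finset.sum_congr rfl fun i _ => Finset.sum_congr rfl fun j _ => by ring
  have hbb : ∀ q q', ∑ k, b q k * b q' k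
      = (∑ j, x q.1 j * x q'.1 j) + ∑ i, y q.2 i * y q'.2 i := by
    intro q q'
    simp [hb, Fintype.sum_sum_type]
  have cs : ∀ {K : Type _} [Fintype K] (s t : K → ℝ), ∑ k, s k ^ 2 = 1 → ∑ k, t k ^ 2 = 1 →
      ∑ k, s k * t k ≤ 1 := by
    intro K _ s t hs ht
    have : ∑ k, s k * t k ≤ ∑ k, (s k ^ 2 + t k ^ 2) / 2 :=
      Finset.sum_le_sum fun k _ => by nlinarith [sq_nonneg (s k - t k)]
    rw [← Finset.sum_div, Finset.sum_add_distrib, hs, ht] at this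
    linarith
  have cs2 : ∀ {K : Type _} [Fintype K] (s t : K → ℝ), ∑ k, s k ^ 2 = 1 → ∑ k, t k ^ 2 = 1 →
      ∑ k, s k * t k ≤ 1 := by
    intro K _ s t hs ht
    have : ∑ k, s k * t k ≤ ∑ k, (s k ^ 2 + t k ^ 2) / 2 :=
      Finset.sum_le_sum fun k _ => by nlinarith [sq_nonneg (s k - t k)]
    rw [← Finset.sum_div, Finset.sum_add_distrib, hs, ht] at this
    linarith
  have key := soft_compare a b β p κ hκ hκ1
    (fun q q' => by simp [ha, hb, Fintype.sum_sum_type])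
    (fun u v v' => by
      rw [haa, hbb]
      have : ∑ j, x u j * x u j = 1 := by rw [← hx u]; simp only [sq]
      simp only [this]; ring)
    (fun q q' => by
      rw [haa, hbb]
      have h1 := cs (x q.1) (x q'.1) (hx _) (hx _)
      have h2 := cs2 (y q.2) (y q'.2) (hy _) (hy _)
      nlinarith)
  have eL := gpi_sum_mul2
    (fun A : M × N → ℝ => sPhi β p κ (fun q : U × V => ∑ k : M × N, (y q.2 k.1 * x q.1 k.2) * A k))
    (fun c : Unit → ℝ => Real.exp ((κ * β * p) * c ()))
    (fun _ : N → ℝ => (1:ℝ)) (fun _ : M → ℝ => (1:ℝ))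
  have eR := gpi_sum_mul2 (fun _ : M × N → ℝ => (1:ℝ)) (fun _ : Unit → ℝ => (1:ℝ))
    (fun g : N → ℝ => (∑ u, Real.exp (β * p * ∑ j, x u j * g j)) ^ κ)
    (fun h : M → ℝ => (∑ v, Real.exp (β * ∑ i, y v i * h i)) ^ (p * κ))
  simp only [integral_const, probReal_univ, smul_eq_mul, mul_one, one_mul, gpi_unit_exp] at eL eR
  rw [← eR, mul_comm, ← eL]
  convert key using 4 with w w
  · rw [mul_comm, ← sPhi_shift]
    congr 1; ext q
    simp [ha, Fintype.sum_sum_type]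
  · rw [← sPhi_split]
    congr 1; ext q
    simp [hb, Fintype.sum_sum_type]
end chevet

section chi
set_option linter.unusedSectionVars false
set_option linter.unusedVariables false

lemma gauss_quad (b : ℝ) (hb : b < 1) :
    Integrable (fun x : ℝ => Real.exp (b / 2 * x ^ 2)) (gaussianReal 0 1) ∧
    ∫ x, Real.exp (b / 2 * x ^ 2) ∂(gaussianReal 0 1) = 1 / Real.sqrt (1 - b) := by
  have e : ∀ x : ℝ, gaussianPDFReal 0 1 x * Real.exp (b / 2 * x ^ 2)
      = (Real.sqrt (2 * Real.pi))⁻¹ * Real.exp (-((1 - b) / 2) * x ^ 2) := by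
    intro x
    simp only [gaussianPDFReal, sub_zero, NNReal.coe_one, mul_one]
    rw [mul_assoc, ← Real.exp_add]
    congr 2; ring
  have hb' : 0 < (1 - b) / 2 := by linarith
  constructor
  · rw [gaussianReal_of_var_ne_zero _ one_ne_zero]
    rw [integrable_withDensity_iff_integrable_smul' (by fun_prop)
      (Filter.Eventually.of_forall fun x => by simp [gaussianPDF])]
    have := (integrable_exp_neg_mul_sq hb').const_mul (Real.sqrt (2 * Real.pi))⁻¹
    refine this.congr (Filter.Eventually.of_forall fun x => ?_)
    simp only [toReal_gaussianPDF, smul_eq_mul]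
    rw [e]
  · rw [integral_gaussianReal_eq_integral_smul one_ne_zero]
    simp only [smul_eq_mul, e]
    rw [integral_const_mul, integral_gaussian]
    rw [← Real.sqrt_inv, ← Real.sqrt_mul (by positivity), one_div, ← Real.sqrt_inv]
    congr 1
    have : Real.pi ≠ 0 := Real.pi_ne_zero
    have : 1 - b ≠ 0 := by linarith
    field_simp

lemma gauss_quad_pi {N : Type*} [Fintype N] (b : ℝ) (hb : b < 1) :
    Integrable (fun w : N → ℝ => Real.exp (b / 2 * ∑ i, w i ^ 2)) (gpi N) ∧
    ∫ w : N → ℝ, Real.exp (b / 2 * ∑ i, w i ^ 2) ∂(gpi N)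
      = (1 / Real.sqrt (1 - b)) ^ (Fintype.card N) := by
  have e : (fun w : N → ℝ => Real.exp (b / 2 * ∑ i, w i ^ 2))
      = fun w => ∏ i, Real.exp (b / 2 * w i ^ 2) := by
    ext w; rw [Finset.mul_sum, Real.exp_sum]
  rw [e]
  constructor
  · exact Integrable.fintype_prod (ι := N) (𝕜 := ℝ) (μ := fun _ => gaussianReal 0 1)
      (f := fun _ x => Real.exp (b / 2 * x ^ 2)) (fun _ => (gauss_quad b hb).1)
  · rw [← (gauss_quad b hb).2]
    exact integral_fintype_prod_eq_pow (ι := N) (fun x : ℝ => Real.exp (b / 2 * x ^ 2))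

lemma sqrt_sum_le_abs {N : Type*} [Fintype N] (w : N → ℝ) :
    Real.sqrt (∑ i, w i ^ 2) ≤ ∑ i, |w i| := by
  rw [Real.sqrt_le_left (Finset.sum_nonneg fun i _ => abs_nonneg _)]
  have : ∑ i, w i ^ 2 = ∑ i, |w i| ^ 2 := by simp
  rw [this]
  exact Finset.sum_sq_le_sq_sum_of_nonneg (fun i _ => abs_nonneg _)

lemma eb_exp_R {N : Type*} [Fintype N] (l : ℝ) :
    EB (fun w : N → ℝ => Real.exp (l * Real.sqrt (∑ i, w i ^ 2))) := by
  refine ⟨1, |l|, by norm_num, abs_nonneg _, fun w => ?_⟩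
  rw [abs_of_pos (Real.exp_pos _), one_mul]
  apply Real.exp_le_exp.2
  calc _ ≤ |l| * Real.sqrt (∑ i, w i ^ 2) := by
        gcongr; exact le_abs_self l
    _ ≤ _ := by gcongr; exact sqrt_sum_le_abs w

theorem chi_upper {N : Type*} [Fintype N] (hN : 0 < Fintype.card N) (l : ℝ) (hl : 0 ≤ l) :
    ∫ w : N → ℝ, Real.exp (l * Real.sqrt (∑ i, w i ^ 2)) ∂(gpi N)
      ≤ Real.exp (l * Real.sqrt (Fintype.card N) + l ^ 2 / 2) := by
  set n := Fintype.card N with hn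
  have hn0 : (0:ℝ) < n := by exact_mod_cast hN
  set q := Real.sqrt (n:ℝ) with hq
  have hq0 : 0 < q := Real.sqrt_pos.2 hn0
  have hqq : q ^ 2 = n := Real.sq_sqrt hn0.le
  set a := q + l with ha
  have ha0 : 0 < a := by positivity
  have hb : l / a < 1 := by rw [div_lt_one ha0]; linarith
  have h1b : 1 - l / a = q / a := by field_simp; linarith
  obtain ⟨i1, i2⟩ := gauss_quad_pi (N := N) (l / a) hb
  calc _ ≤ ∫ w : N → ℝ, Real.exp (l * a / 2) * Real.exp (l / a / 2 * ∑ i, w i ^ 2) ∂(gpi N) := by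
        refine integral_mono ((eb_exp_R l).integrable (by fun_prop)) (i1.const_mul _) fun w => ?_
        simp only []
        rw [← Real.exp_add]
        apply Real.exp_le_exp.2
        set R := Real.sqrt (∑ i, w i ^ 2) with hR
        have hRR : R ^ 2 = ∑ i, w i ^ 2 := Real.sq_sqrt (Finset.sum_nonneg fun i _ => sq_nonneg _)
        rw [← hRR]
        have : l * a / 2 + l / a / 2 * R ^ 2 - l * R = l / a / 2 * (R - a) ^ 2 := by
          field_simp; ring
        have h2 : 0 ≤ l / a / 2 * (R - a) ^ 2 := by positivity
        linarith
    _ = Real.exp (l * a / 2) * (1 / Real.sqrt (q / a)) ^ n := by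
        rw [integral_const_mul, i2, h1b]
    _ ≤ Real.exp (l * a / 2) * Real.exp (l * q / 2) := by
        gcongr
        have e1 : 1 / Real.sqrt (q / a) = Real.sqrt (1 + l / q) := by
          rw [one_div, ← Real.sqrt_inv]; congr 1; rw [ha]; field_simp
        have e2 : Real.sqrt (1 + l / q) ≤ Real.exp (l / q / 2) := by
          rw [Real.sqrt_le_left (Real.exp_pos _).le, ← Real.exp_nat_mul]
          have := Real.add_one_le_exp (l / q)
          refine (by linarith : 1 + l / q ≤ _).trans (this.trans (le_of_eq ?_))
          congr 1; push_cast; ring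
        rw [e1]
        calc _ ≤ Real.exp (l / q / 2) ^ n := by gcongr
          _ = Real.exp (l * q / 2) := by
            rw [← Real.exp_nat_mul]; congr 1
            rw [← hqq]; field_simp
    _ = _ := by
        rw [← Real.exp_add]; congr 1; rw [ha]; ring

variable {N : Type*} [Fintype N] [DecidableEq N]

/-- Regularized Euclidean norm. -/
def rQ (ε : ℝ) (w : N → ℝ) : ℝ := Real.sqrt (ε + ∑ i, w i ^ 2)

lemma rQ_pos {ε : ℝ} (hε : 0 < ε) (w : N → ℝ) : 0 < rQ ε w :=
  Real.sqrt_pos.2 (add_pos_of_pos_of_nonneg hε (Finset.sum_nonneg fun i _ => sq_nonneg _))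

lemma rQ_sq {ε : ℝ} (hε : 0 < ε) (w : N → ℝ) : rQ ε w ^ 2 = ε + ∑ i, w i ^ 2 :=
  Real.sq_sqrt (add_pos_of_pos_of_nonneg hε (Finset.sum_nonneg fun i _ => sq_nonneg _)).le

lemma rQ_meas (ε : ℝ) : Measurable (rQ (N := N) ε) := by
  unfold rQ; fun_prop

lemma rQ_le {ε : ℝ} (hε : 0 < ε) (w : N → ℝ) :
    rQ ε w ≤ Real.sqrt ε + Real.sqrt (∑ i, w i ^ 2) :=
  by
  have h1 : (0:ℝ) ≤ ∑ i, w i ^ 2 := Finset.sum_nonneg fun i _ => sq_nonneg _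
  have h2 := Real.sq_sqrt hε.le
  have h3 := Real.sq_sqrt h1
  have h4 := Real.sqrt_nonneg ε
  have h5 := Real.sqrt_nonneg (∑ i, w i ^ 2)
  rw [rQ, Real.sqrt_le_left (by positivity)]
  nlinarith [mul_nonneg h4 h5]

lemma rQ_eb {ε : ℝ} (hε : 0 < ε) : EB (rQ (N := N) ε) := by
  refine ⟨Real.sqrt ε + 1, 1, by positivity, by norm_num, fun w => ?_⟩
  rw [abs_of_pos (rQ_pos hε w)]
  refine (rQ_le hε w).trans ?_
  have h1 := sqrt_sum_le_abs w
  have h2 := Real.add_one_le_exp (1 * ∑ i, |w i|)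
  have h3 : 0 ≤ ∑ i, |w i| := Finset.sum_nonneg fun i _ => abs_nonneg _
  have h4 : 0 ≤ Real.sqrt ε := Real.sqrt_nonneg _
  nlinarith

lemma eb_bdd {f : (N → ℝ) → ℝ} (C : ℝ) (h : ∀ w, |f w| ≤ C) : EB f := by
  refine ⟨C, 0, (abs_nonneg _).trans (h 0), le_rfl, fun w => ?_⟩
  simpa using h w

lemma rQ_hasDeriv {ε : ℝ} (hε : 0 < ε) (k : N) (w : N → ℝ) (t : ℝ) :
    HasDerivAt (fun x => rQ ε (Function.update w k x)) (t / rQ ε (Function.update w k t)) t := by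
  have h1 : ∀ x, ε + ∑ i, (Function.update w k x) i ^ 2
      = ε + (x ^ 2 + ∑ i ∈ Finset.univ.erase k, w i ^ 2) := by
    intro x
    rw [← Finset.add_sum_erase _ _ (Finset.mem_univ k)]
    simp only [Function.update_self]
    congr 2
    refine Finset.sum_congr rfl fun i hi => ?_
    rw [Function.update_of_ne (Finset.ne_of_mem_erase hi)]
  have hp := rQ_pos hε (Function.update w k t)
  unfold rQ at *
  simp only [h1] at *
  have h2 : HasDerivAt (fun x : ℝ => ε + (x ^ 2 + ∑ i ∈ Finset.univ.erase k, w i ^ 2)) (2 * t) t := by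
    have := (((hasDerivAt_id t).pow 2).add_const (∑ i ∈ Finset.univ.erase k, w i ^ 2)).const_add ε
    simpa using this
  have h3 := h2.sqrt (by
    intro h; rw [h] at hp; simp at hp)
  convert h3 using 1
  field_simp

lemma rQ_sqrt_le {ε : ℝ} (hε : 0 < ε) (w : N → ℝ) : Real.sqrt ε ≤ rQ ε w :=
  Real.sqrt_le_sqrt (le_add_of_nonneg_right (Finset.sum_nonneg fun i _ => sq_nonneg _))

lemma coord_le_rQ {ε : ℝ} (hε : 0 < ε) (w : N → ℝ) (k : N) : |w k| ≤ rQ ε w := by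
  apply Real.abs_le_sqrt
  have := Finset.single_le_sum (f := fun i => w i ^ 2) (fun i _ => sq_nonneg _) (Finset.mem_univ k)
  have h2 : w k ^ 2 ≤ ∑ i, w i ^ 2 := this
  linarith

lemma rQ_stein {ε : ℝ} (hε : 0 < ε) (l : ℝ) (hl : 0 ≤ l) (k : N) :
    ∫ w : N → ℝ, w k * (w k / rQ ε w * Real.exp (-l * rQ ε w)) ∂(gpi N)
    = ∫ w : N → ℝ, (1 / rQ ε w - w k ^ 2 / rQ ε w ^ 3 - l * w k ^ 2 / rQ ε w ^ 2)
        * Real.exp (-l * rQ ε w) ∂(gpi N) := by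
  have hm := rQ_meas (N := N) ε
  have hexp : ∀ w : N → ℝ, Real.exp (-l * rQ ε w) ≤ 1 := by
    intro w
    rw [Real.exp_le_one_iff]
    have := rQ_pos hε w
    nlinarith
  have hs0 : 0 < Real.sqrt ε := Real.sqrt_pos.2 hε
  refine stein_multi k _ _ ?_ (by fun_prop) (by fun_prop) ?_ ?_
  · intro w t
    have h := rQ_hasDeriv hε k w t
    have hp := rQ_pos hε (Function.update w k t)
    simp only [Function.update_self]
    have h1 := ((hasDerivAt_id t).div h hp.ne').mul (h.const_mul (-l)).exp
    refine h1.congr_deriv ?_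
    simp only [id, Pi.div_apply]
    field_simp
    ring
  · refine eb_bdd 1 fun w => ?_
    rw [abs_mul, abs_div, abs_of_pos (Real.exp_pos _), abs_of_pos (rQ_pos hε w)]
    have := coord_le_rQ hε w k
    exact mul_le_one₀ ((div_le_one (rQ_pos hε w)).2 this) (Real.exp_pos _).le (hexp w)
  · refine eb_bdd (2 / Real.sqrt ε + l) fun w => ?_
    rw [abs_mul, abs_of_pos (Real.exp_pos _)]
    have hp := rQ_pos hε w
    have hc := coord_le_rQ hε w k
    have hs := rQ_sqrt_le hε w
    have hc2 : w k ^ 2 / rQ ε w ^ 2 ≤ 1 := by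
      rw [div_le_one (by positivity)]
      exact sq_le_sq.2 (by rwa [abs_of_pos hp])
    have hc3 : 0 ≤ w k ^ 2 / rQ ε w ^ 2 := by positivity
    have hi : 1 / rQ ε w ≤ 1 / Real.sqrt ε := one_div_le_one_div_of_le hs0 hs
    have hi0 : 0 < 1 / rQ ε w := by positivity
    have e1 : w k ^ 2 / rQ ε w ^ 3 = w k ^ 2 / rQ ε w ^ 2 * (1 / rQ ε w) := by field_simp
    have e2 : l * w k ^ 2 / rQ ε w ^ 2 = l * (w k ^ 2 / rQ ε w ^ 2) := by ring
    have e3 : 2 / Real.sqrt ε = 1 / Real.sqrt ε + 1 / Real.sqrt ε := by ring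
    rw [e1, e2]
    have hb : |1 / rQ ε w - w k ^ 2 / rQ ε w ^ 2 * (1 / rQ ε w) - l * (w k ^ 2 / rQ ε w ^ 2)|
        ≤ 2 / Real.sqrt ε + l := by
      rw [e3, abs_le]
      constructor <;> nlinarith
    calc _ ≤ (2 / Real.sqrt ε + l) * 1 := by
          gcongr
          exact hexp w
      _ = _ := mul_one _

lemma rQ_main {ε : ℝ} (hε : 0 < ε) (l : ℝ) (hl : 0 ≤ l) (hN : 2 ≤ Fintype.card N) :
    (Real.sqrt ((Fintype.card N : ℝ) - 1) - l / 2) * ∫ w : N → ℝ, Real.exp (-l * rQ ε w) ∂(gpi N)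
      ≤ ∫ w : N → ℝ, rQ ε w * Real.exp (-l * rQ ε w) ∂(gpi N) := by
  have hm := rQ_meas (N := N) ε
  have hexp : ∀ w : N → ℝ, Real.exp (-l * rQ ε w) ≤ 1 := by
    intro w
    rw [Real.exp_le_one_iff]
    have := rQ_pos hε w
    nlinarith
  have ebe : EB (fun w : N → ℝ => Real.exp (-l * rQ ε w)) :=
    eb_bdd 1 fun w => by rw [abs_of_pos (Real.exp_pos _)]; exact hexp w
  have hs0 : 0 < Real.sqrt ε := Real.sqrt_pos.2 hε
  have ebi : EB (fun w : N → ℝ => 1 / rQ ε w) :=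
    eb_bdd (1 / Real.sqrt ε) fun w => by
      rw [abs_of_pos (by have := rQ_pos hε w; positivity)]
      exact one_div_le_one_div_of_le hs0 (rQ_sqrt_le hε w)
  have ebc : ∀ k : N, EB (fun w : N → ℝ => w k / rQ ε w) := fun k =>
    eb_bdd 1 fun w => by
      rw [abs_div, abs_of_pos (rQ_pos hε w)]
      exact (div_le_one (rQ_pos hε w)).2 (coord_le_rQ hε w k)
  have i1 : ∀ k, Integrable (fun w : N → ℝ => w k * (w k / rQ ε w * Real.exp (-l * rQ ε w))) (gpi N) :=
    fun k => ((EB.coord k).mul ((ebc k).mul ebe)).integrable (by fun_prop)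
  have i2 : ∀ k, Integrable (fun w : N → ℝ =>
      (1 / rQ ε w - w k ^ 2 / rQ ε w ^ 3 - l * w k ^ 2 / rQ ε w ^ 2)
        * Real.exp (-l * rQ ε w)) (gpi N) := by
    intro k
    have : (fun w : N → ℝ =>
      (1 / rQ ε w - w k ^ 2 / rQ ε w ^ 3 - l * w k ^ 2 / rQ ε w ^ 2) * Real.exp (-l * rQ ε w))
      = fun w => (1 / rQ ε w + ((-1) * ((w k / rQ ε w) * ((w k / rQ ε w) * (1 / rQ ε w)))
        + (-l) * ((w k / rQ ε w) * (w k / rQ ε w)))) * Real.exp (-l * rQ ε w) := by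
      ext w
      have := rQ_pos hε w
      field_simp
      ring
    rw [this]
    exact ((ebi.add (((EB.const _).mul ((ebc k).mul ((ebc k).mul ebi))).add
      ((EB.const _).mul ((ebc k).mul (ebc k))))).mul ebe).integrable (by fun_prop)
  set n : ℝ := (Fintype.card N : ℝ) - 1 with hn
  have hn0 : 0 < n := by
    have : (2:ℝ) ≤ Fintype.card N := by exact_mod_cast hN
    rw [hn]; linarith
  set q := Real.sqrt n with hq
  have hq0 : 0 < q := Real.sqrt_pos.2 hn0
  have hqq : q ^ 2 = n := Real.sq_sqrt hn0.le
  have ie := ebe.integrable (by fun_prop)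
  have iq := ((rQ_eb (N := N) hε).mul ebe).integrable (by fun_prop)
  have key := Finset.sum_congr (rfl : (Finset.univ : Finset N) = Finset.univ)
    fun k _ => rQ_stein (N := N) hε l hl k
  rw [← integral_finsetSum _ (fun k _ => i1 k), ← integral_finsetSum _ (fun k _ => i2 k)] at key
  have lo : ∫ w : N → ℝ, ∑ k, w k * (w k / rQ ε w * Real.exp (-l * rQ ε w)) ∂(gpi N)
      ≤ ∫ w : N → ℝ, rQ ε w * Real.exp (-l * rQ ε w) ∂(gpi N) := by
    refine integral_mono (integrable_finsetSum _ fun k _ => i1 k) iq fun w => ?_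
    have hp := rQ_pos hε w
    have : ∑ k, w k * (w k / rQ ε w * Real.exp (-l * rQ ε w))
        = (rQ ε w ^ 2 - ε) / rQ ε w * Real.exp (-l * rQ ε w) := by
      rw [rQ_sq hε, add_sub_cancel_left, Finset.sum_div, Finset.sum_mul]
      exact Finset.sum_congr rfl fun k _ => by ring
    simp only [this]
    gcongr
    rw [div_le_iff₀ hp]
    nlinarith
  have hi : ∫ w : N → ℝ, ((2 * q - l) * Real.exp (-l * rQ ε w) + (-1) * (rQ ε w * Real.exp (-l * rQ ε w))) ∂(gpi N)
      ≤ ∫ w : N → ℝ, ∑ k, (1 / rQ ε w - w k ^ 2 / rQ ε w ^ 3 - l * w k ^ 2 / rQ ε w ^ 2)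
        * Real.exp (-l * rQ ε w) ∂(gpi N) := by
    refine integral_mono ((ie.const_mul _).add (iq.const_mul _))
      (integrable_finsetSum _ fun k _ => i2 k) fun w => ?_
    have hp := rQ_pos hε w
    have : ∑ k, (1 / rQ ε w - w k ^ 2 / rQ ε w ^ 3 - l * w k ^ 2 / rQ ε w ^ 2)
        * Real.exp (-l * rQ ε w)
        = ((n + 1) / rQ ε w - (rQ ε w ^ 2 - ε) / rQ ε w ^ 3 - l * (rQ ε w ^ 2 - ε) / rQ ε w ^ 2)
        * Real.exp (-l * rQ ε w) := by
      rw [← Finset.sum_mul, rQ_sq hε, add_sub_cancel_left, Finset.sum_sub_distrib,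
        Finset.sum_sub_distrib, Finset.sum_div, Finset.mul_sum, Finset.sum_div]
      simp [hn]
      rfl
    simp only [this]
    have e : (2 * q - l) * Real.exp (-l * rQ ε w) + (-1) * (rQ ε w * Real.exp (-l * rQ ε w))
      = (2 * q - l - rQ ε w) * Real.exp (-l * rQ ε w) := by ring
    rw [e]
    refine mul_le_mul_of_nonneg_right ?_ (Real.exp_pos _).le
    have e2 : (n + 1) / rQ ε w - (rQ ε w ^ 2 - ε) / rQ ε w ^ 3 - l * (rQ ε w ^ 2 - ε) / rQ ε w ^ 2
        - (2 * q - l - rQ ε w) = (q - rQ ε w) ^ 2 / rQ ε w + ε / rQ ε w ^ 3 + l * ε / rQ ε w ^ 2 := by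
      rw [← hqq]; field_simp; ring
    have : 0 ≤ (q - rQ ε w) ^ 2 / rQ ε w + ε / rQ ε w ^ 3 + l * ε / rQ ε w ^ 2 := by positivity
    linarith
  rw [integral_add (ie.const_mul _) (iq.const_mul _), integral_const_mul, integral_const_mul] at hi
  rw [key] at lo
  linarith

lemma rQ_deriv {ε : ℝ} (hε : 0 < ε) (l : ℝ) :
    HasDerivAt (fun l => ∫ w : N → ℝ, Real.exp (-l * rQ ε w) ∂(gpi N))
      (∫ w : N → ℝ, -(rQ ε w * Real.exp (-l * rQ ε w)) ∂(gpi N)) l := by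
  have hm := rQ_meas (N := N) ε
  have ebe : ∀ c, EB (fun w : N → ℝ => Real.exp (c * rQ ε w)) := fun c => by
    refine ⟨Real.exp (|c| * Real.sqrt ε), |c|, (Real.exp_pos _).le, abs_nonneg _, fun w => ?_⟩
    rw [abs_of_pos (Real.exp_pos _), ← Real.exp_add]
    apply Real.exp_le_exp.2
    have h1 := rQ_le hε w
    have h2 := sqrt_sum_le_abs w
    calc c * rQ ε w ≤ |c| * rQ ε w := by
          gcongr
          · exact (rQ_pos hε w).le
          · exact le_abs_self c
      _ ≤ |c| * (Real.sqrt ε + ∑ i, |w i|) := by gcongr; linarith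
      _ = _ := by ring
  refine (hasDerivAt_integral_of_dominated_loc_of_deriv_le (μ := gpi N)
    (F := fun l (w : N → ℝ) => Real.exp (-l * rQ ε w))
    (F' := fun l (w : N → ℝ) => -(rQ ε w * Real.exp (-l * rQ ε w))) (s := Metric.ball l 1)
    (bound := fun w : N → ℝ => rQ ε w * Real.exp ((|l| + 1) * rQ ε w))
    (Metric.ball_mem_nhds l one_pos) ?_ ?_ ?_ ?_ ?_ ?_).2
  · exact Filter.Eventually.of_forall fun x => by fun_prop
  · exact (ebe _).integrable (by fun_prop)
  · fun_prop
  · refine Filter.Eventually.of_forall fun w x hx => ?_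
    have hp := rQ_pos hε w
    rw [norm_neg, Real.norm_eq_abs, abs_of_pos (by positivity)]
    gcongr
    rw [Metric.mem_ball, Real.dist_eq] at hx
    have h1 := abs_lt.1 hx
    have h2 := neg_abs_le l
    linarith
  · exact ((rQ_eb hε).mul (ebe _)).integrable (by fun_prop)
  · refine Filter.Eventually.of_forall fun w x hx => ?_
    have := ((hasDerivAt_id x).neg.mul_const (rQ ε w)).exp
    refine this.congr_deriv ?_
    simp
    ring

lemma rQ_bound {ε : ℝ} (hε : 0 < ε) (l : ℝ) (hl : 0 ≤ l) (hN : 2 ≤ Fintype.card N) :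
    ∫ w : N → ℝ, Real.exp (-l * rQ ε w) ∂(gpi N)
      ≤ Real.exp (-l * Real.sqrt ((Fintype.card N : ℝ) - 1) + l ^ 2 / 4) := by
  set q := Real.sqrt ((Fintype.card N : ℝ) - 1) with hq
  set J := fun l => ∫ w : N → ℝ, Real.exp (-l * rQ ε w) ∂(gpi N) with hJ
  have hd : ∀ x, HasDerivAt (fun x => J x * Real.exp (x * q - x ^ 2 / 4))
      ((∫ w : N → ℝ, -(rQ ε w * Real.exp (-x * rQ ε w)) ∂(gpi N)) * Real.exp (x * q - x ^ 2 / 4)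
        + J x * (Real.exp (x * q - x ^ 2 / 4) * (q - x / 2))) x := by
    intro x
    have h1 := rQ_deriv (N := N) hε x
    have h2 : HasDerivAt (fun x : ℝ => x * q - x ^ 2 / 4) (q - x / 2) x := by
      have := ((hasDerivAt_id x).mul_const q).sub (((hasDerivAt_id x).pow 2).div_const 4)
      refine this.congr_deriv ?_
      simp; ring
    exact h1.mul h2.exp
  have ha : AntitoneOn (fun x => J x * Real.exp (x * q - x ^ 2 / 4)) (Set.Ici 0) := by
    refine antitoneOn_of_deriv_nonpos (convex_Ici 0)
      (fun x _ => (hd x).continuousAt.continuousWithinAt)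
      (fun x _ => (hd x).differentiableAt.differentiableWithinAt) fun x hx => ?_
    rw [(hd x).deriv]
    rw [interior_Ici] at hx
    have h := rQ_main (N := N) hε x (le_of_lt hx) hN
    rw [integral_neg]
    have he := Real.exp_pos (x * q - x ^ 2 / 4)
    have : (q - x / 2) * J x ≤ ∫ w : N → ℝ, rQ ε w * Real.exp (-x * rQ ε w) ∂(gpi N) := h
    nlinarith
  have := ha (Set.mem_Ici.2 le_rfl) (Set.mem_Ici.2 hl) hl
  simp [hJ] at this
  have e : Real.exp (-l * q + l ^ 2 / 4) = 1 / Real.exp (l * q - l ^ 2 / 4) := by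
    rw [one_div, ← Real.exp_neg]; congr 1; ring
  rw [e, le_div_iff₀ (Real.exp_pos _)]
  simpa using this

theorem chi_lower (l : ℝ) (hl : 0 ≤ l) (hN : 2 ≤ Fintype.card N) :
    ∫ w : N → ℝ, Real.exp (-l * Real.sqrt (∑ i, w i ^ 2)) ∂(gpi N)
      ≤ Real.exp (-l * Real.sqrt ((Fintype.card N : ℝ) - 1) + l ^ 2 / 4) := by
  have h : ∀ δ : ℝ, 0 < δ → ∫ w : N → ℝ, Real.exp (-l * Real.sqrt (∑ i, w i ^ 2)) ∂(gpi N)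
      ≤ Real.exp (l * δ) * Real.exp (-l * Real.sqrt ((Fintype.card N : ℝ) - 1) + l ^ 2 / 4) := by
    intro δ hδ
    have hε : 0 < δ ^ 2 := by positivity
    have hm := rQ_meas (N := N) (δ ^ 2)
    refine le_trans ?_ (mul_le_mul_of_nonneg_left (rQ_bound hε l hl hN) (Real.exp_pos _).le)
    rw [← integral_const_mul]
    refine integral_mono ((eb_exp_R _).integrable (by fun_prop)) ?_ fun w => ?_
    · refine ((EB.const _).mul (eb_bdd 1 fun w => ?_)).integrable (by fun_prop)
      rw [abs_of_pos (Real.exp_pos _), Real.exp_le_one_iff]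
      have := rQ_pos hε w
      nlinarith
    · simp only []
      rw [← Real.exp_add]
      apply Real.exp_le_exp.2
      have := rQ_le hε w
      rw [Real.sqrt_sq hδ.le] at this
      nlinarith
  have ht : Filter.Tendsto (fun δ : ℝ => Real.exp (l * δ) *
      Real.exp (-l * Real.sqrt ((Fintype.card N : ℝ) - 1) + l ^ 2 / 4))
      (nhdsWithin 0 (Set.Ioi 0))
      (nhds (Real.exp (l * 0) * Real.exp (-l * Real.sqrt ((Fintype.card N : ℝ) - 1) + l ^ 2 / 4))) := by
    apply Filter.Tendsto.mono_left _ nhdsWithin_le_nhds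
    apply Continuous.tendsto (f := fun δ : ℝ => Real.exp (l * δ) *
      Real.exp (-l * Real.sqrt ((Fintype.card N : ℝ) - 1) + l ^ 2 / 4))
    fun_prop
  simp only [mul_zero, Real.exp_zero, one_mul] at ht
  exact ge_of_tendsto ht (Filter.eventually_of_mem self_mem_nhdsWithin fun δ hδ => h δ hδ)
end chi

section tails
set_option linter.unusedSectionVars false
set_option linter.unusedVariables false
variable {U V M N : Type*} [Fintype U] [Fintype V] [Fintype M] [Fintype N] [Nonempty U] [Nonempty V]
  [DecidableEq U] [DecidableEq V] [DecidableEq M] [DecidableEq N]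

/-- The bilinear form attached to a matrix. -/
def bil (A : M × N → ℝ) (x : N → ℝ) (y : M → ℝ) : ℝ := ∑ k : M × N, (y k.1 * x k.2) * A k

lemma lin_le_R {N : Type*} [Fintype N] (x g : N → ℝ) (hx : ∑ j, x j ^ 2 = 1) :
    |∑ j, x j * g j| ≤ Real.sqrt (∑ j, g j ^ 2) := by
  apply Real.abs_le_sqrt
  have := Finset.sum_mul_sq_le_sq_mul_sq Finset.univ x g
  rwa [hx, one_mul] at this

lemma sPhi_integrable (x : U → N → ℝ) (y : V → M → ℝ) (β p κ : ℝ) :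
    Integrable (fun A : M × N → ℝ =>
      sPhi β p κ (fun q : U × V => ∑ k : M × N, (y q.2 k.1 * x q.1 k.2) * A k)) (gpi (M × N)) := by
  have h := ((sS_lb (U := U) (V := V) β p).rpow κ).eb
  obtain ⟨C, c, hC, hc, hb⟩ := h.comp_lin (fun (q : U × V) (k : M × N) => y q.2 k.1 * x q.1 k.2)
    (fun _ _ => 0)
  refine EB.integrable ⟨C, c, hC, hc, fun w => ?_⟩ ?_
  · have := hb 1 0 (by simp) (by simp) w
    simpa [sPhi] using this
  · apply Continuous.measurable
    have h1 : Continuous (fun A : M × N → ℝ => sS β p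
        (fun q : U × V => ∑ k : M × N, (y q.2 k.1 * x q.1 k.2) * A k)) :=
      (sS_cont β p).comp (by fun_prop)
    exact h1.rpow_const fun z => Or.inl (sS_pos β p _).ne'

lemma softsum_le {U N : Type*} [Fintype U] [Fintype N] [Nonempty U] (x : U → N → ℝ)
    (hx : ∀ u, ∑ j, x u j ^ 2 = 1) (b κ : ℝ) (hκ : 0 < κ) (g : N → ℝ) :
    (∑ u, Real.exp (b * ∑ j, x u j * g j)) ^ κ
      ≤ (Fintype.card U : ℝ) ^ κ * Real.exp ((κ * |b|) * Real.sqrt (∑ j, g j ^ 2)) := by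
  have h1 : ∑ u, Real.exp (b * ∑ j, x u j * g j)
      ≤ Fintype.card U * Real.exp (|b| * Real.sqrt (∑ j, g j ^ 2)) := by
    calc _ ≤ ∑ _u : U, Real.exp (|b| * Real.sqrt (∑ j, g j ^ 2)) := by
          refine Finset.sum_le_sum fun u _ => Real.exp_le_exp.2 ?_
          refine (le_abs_self _).trans ?_
          rw [abs_mul]
          gcongr
          exact lin_le_R _ _ (hx u)
      _ = _ := by simp
  calc _ ≤ (Fintype.card U * Real.exp (|b| * Real.sqrt (∑ j, g j ^ 2))) ^ κ :=
        Real.rpow_le_rpow (Finset.sum_nonneg fun _ _ => (Real.exp_pos _).le) h1 hκ.le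
    _ = _ := by
        rw [Real.mul_rpow (by positivity) (Real.exp_pos _).le, ← Real.exp_mul]
        congr 2; ring

lemma softsum_int_le {U N : Type*} [Fintype U] [Fintype N] [Nonempty U] (x : U → N → ℝ)
    (hx : ∀ u, ∑ j, x u j ^ 2 = 1) (b κ : ℝ) (hκ : 0 < κ) :
    ∫ g : N → ℝ, (∑ u, Real.exp (b * ∑ j, x u j * g j)) ^ κ ∂(gpi N)
      ≤ (Fintype.card U : ℝ) ^ κ *
        ∫ g : N → ℝ, Real.exp ((κ * |b|) * Real.sqrt (∑ j, g j ^ 2)) ∂(gpi N) := by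
  rw [← integral_const_mul]
  refine integral_mono_of_nonneg (Filter.Eventually.of_forall fun g => ?_)
    (((eb_exp_R _).integrable (by fun_prop)).const_mul _)
    (Filter.Eventually.of_forall fun g => softsum_le x hx b κ hκ g)
  exact Real.rpow_nonneg (Finset.sum_nonneg fun _ _ => (Real.exp_pos _).le) _

lemma kappa_limit (P B : ℝ) (a b : ℝ) (ha : 0 < a) (hb : 0 < b)
    (h : ∀ κ : ℝ, 0 < κ → κ ≤ 1 → P ≤ a ^ κ * b ^ κ * B) : P ≤ B := by
  have ht : Filter.Tendsto (fun κ : ℝ => a ^ κ * b ^ κ * B) (nhdsWithin 0 (Set.Ioi 0))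
      (nhds (a ^ (0:ℝ) * b ^ (0:ℝ) * B)) := by
    apply Filter.Tendsto.mono_left _ nhdsWithin_le_nhds
    have c1 : Continuous (fun κ : ℝ => a ^ κ) := Real.continuous_const_rpow ha.ne'
    have c2 : Continuous (fun κ : ℝ => b ^ κ) := Real.continuous_const_rpow hb.ne'
    exact ((c1.mul c2).mul continuous_const).tendsto 0
  simp only [Real.rpow_zero, one_mul] at ht
  refine ge_of_tendsto ht ?_
  filter_upwards [Ioc_mem_nhdsGT (zero_lt_one' ℝ)] with κ hκ
  exact h κ hκ.1 hκ.2

theorem upper_fin (x : U → N → ℝ) (y : V → M → ℝ) (hx : ∀ u, ∑ j, x u j ^ 2 = 1)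
    (hy : ∀ v, ∑ i, y v i ^ 2 = 1) (l c : ℝ) (hl : 0 < l) :
    (gpi (M × N)).real {A | ∃ u v, c ≤ bil A (x u) (y v)} ≤
      Real.exp (-l * c - l ^ 2 / 2) *
      ((∫ g : N → ℝ, Real.exp (l * Real.sqrt (∑ j, g j ^ 2)) ∂(gpi N)) *
       ∫ h : M → ℝ, Real.exp (l * Real.sqrt (∑ j, h j ^ 2)) ∂(gpi M)) := by
  refine kappa_limit _ _ (Fintype.card U) (Fintype.card V) (by exact_mod_cast Fintype.card_pos)
    (by exact_mod_cast Fintype.card_pos) fun κ hκ hκ1 => ?_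
  have key := chevet_gordon x y hx hy (l / κ) 1 κ hκ hκ1
  have e0 : κ * (l / κ) * 1 = l := by field_simp
  have e1 : κ * |l / κ| = l := by rw [abs_of_pos (by positivity)]; field_simp
  have h1 := softsum_int_le x hx (l / κ) κ hκ
  have h2 := softsum_int_le y hy (l / κ) κ hκ
  rw [e1] at h1 h2
  rw [e0, mul_one, one_mul] at key
  set I := ∫ A : M × N → ℝ,
    sPhi (l / κ) 1 κ (fun q : U × V => ∑ k : M × N, (y q.2 k.1 * x q.1 k.2) * A k) ∂(gpi (M × N))
    with hI
  have mk : Real.exp (l * c) * (gpi (M × N)).real {A | ∃ u v, c ≤ bil A (x u) (y v)} ≤ I := by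
    refine le_trans ?_ (mul_meas_ge_le_integral_of_nonneg
      (Filter.Eventually.of_forall fun A => ?_) (sPhi_integrable x y (l / κ) 1 κ)
      (Real.exp (l * c)))
    · refine mul_le_mul_of_nonneg_left (measureReal_mono ?_) (Real.exp_pos _).le
      rintro A ⟨u, v, huv⟩
      simp only [Set.mem_ofPred_eq]
      have : Real.exp (l / κ * c) ≤ sS (l / κ) 1
          (fun q : U × V => ∑ k : M × N, (y q.2 k.1 * x q.1 k.2) * A k) := by
        simp only [sS, Real.rpow_one]
        refine le_trans ?_ (Finset.single_le_sum (fun u _ => (sT_pos _ u _).le) (Finset.mem_univ u))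
        unfold sT
        refine le_trans ?_ (Finset.single_le_sum (fun v _ => (Real.exp_pos _).le) (Finset.mem_univ v))
        apply Real.exp_le_exp.2
        exact mul_le_mul_of_nonneg_left huv (by positivity)
      unfold sPhi
      refine le_trans (le_of_eq ?_) (Real.rpow_le_rpow (Real.exp_pos _).le this hκ.le)
      rw [← Real.exp_mul]; congr 1; field_simp
    · exact Real.rpow_nonneg (sS_pos _ _ _).le _
  have e3 : Real.exp (-l * c - l ^ 2 / 2) = (Real.exp (l ^ 2 / 2))⁻¹ * (Real.exp (l * c))⁻¹ := by
    rw [← Real.exp_neg, ← Real.exp_neg, ← Real.exp_add]; congr 1; ring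
  set G := ∫ g : N → ℝ, Real.exp (l * Real.sqrt (∑ j, g j ^ 2)) ∂(gpi N)
  set H := ∫ h : M → ℝ, Real.exp (l * Real.sqrt (∑ j, h j ^ 2)) ∂(gpi M)
  set P := (gpi (M × N)).real {A | ∃ u v, c ≤ bil A (x u) (y v)}
  have h3 : Real.exp (l ^ 2 / 2) * (Real.exp (l * c) * P) ≤
      ((Fintype.card U : ℝ) ^ κ * G) * ((Fintype.card V : ℝ) ^ κ * H) := by
    refine (mul_le_mul_of_nonneg_left mk (Real.exp_pos _).le).trans (key.trans ?_)
    refine mul_le_mul h1 h2 (integral_nonneg fun h => ?_) (h1.trans' (integral_nonneg fun h => ?_))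
    · exact Real.rpow_nonneg (Finset.sum_nonneg fun _ _ => (Real.exp_pos _).le) _
    · exact Real.rpow_nonneg (Finset.sum_nonneg fun _ _ => (Real.exp_pos _).le) _
  rw [e3]
  have p1 := Real.exp_pos (l ^ 2 / 2)
  have p2 := Real.exp_pos (l * c)
  calc P = (Real.exp (l ^ 2 / 2))⁻¹ * (Real.exp (l * c))⁻¹ *
        (Real.exp (l ^ 2 / 2) * (Real.exp (l * c) * P)) := by field_simp
    _ ≤ (Real.exp (l ^ 2 / 2))⁻¹ * (Real.exp (l * c))⁻¹ *
        (((Fintype.card U : ℝ) ^ κ * G) * ((Fintype.card V : ℝ) ^ κ * H)) := by gcongr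
    _ = _ := by ring

theorem lower_fin (x : U → N → ℝ) (y : V → M → ℝ) (hx : ∀ u, ∑ j, x u j ^ 2 = 1)
    (hy : ∀ v, ∑ i, y v i ^ 2 = 1) (l c θ : ℝ) (hl : 0 < l)
    (hnet : ∀ h : M → ℝ, ∃ v, θ * Real.sqrt (∑ i, h i ^ 2) ≤ ∑ i, y v i * h i) :
    (gpi (M × N)).real {A | ∃ u, ∀ v, bil A (x u) (y v) ≤ c} ≤
      Real.exp (l * c - l ^ 2 / 2) *
      ((∫ g : N → ℝ, Real.exp (l * Real.sqrt (∑ j, g j ^ 2)) ∂(gpi N)) *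
       ∫ h : M → ℝ, Real.exp (-(l * θ) * Real.sqrt (∑ j, h j ^ 2)) ∂(gpi M)) := by
  refine kappa_limit _ _ (Fintype.card U) (Fintype.card V) (by exact_mod_cast Fintype.card_pos)
    (by exact_mod_cast Fintype.card_pos) fun κ hκ hκ1 => ?_
  have key := chevet_gordon x y hx hy (l / κ) (-1) κ hκ hκ1
  have e0 : (κ * (l / κ) * -1) ^ 2 = l ^ 2 := by field_simp
  have e1 : κ * |l / κ * -1| = l := by
    rw [abs_mul, abs_of_pos (by positivity : 0 < l / κ)]; simp; field_simp
  have h1 := softsum_int_le x hx (l / κ * -1) κ hκ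
  have hV : (0:ℝ) < Fintype.card V := by exact_mod_cast Fintype.card_pos
  have h2 : ∫ h : M → ℝ, (∑ v, Real.exp (l / κ * ∑ i, y v i * h i)) ^ (-1 * κ) ∂(gpi M)
      ≤ ∫ h : M → ℝ, Real.exp (-(l * θ) * Real.sqrt (∑ j, h j ^ 2)) ∂(gpi M) := by
    refine integral_mono_of_nonneg (Filter.Eventually.of_forall fun g => ?_)
      ((eb_exp_R _).integrable (by fun_prop)) (Filter.Eventually.of_forall fun h => ?_)
    · exact Real.rpow_nonneg (Finset.sum_nonneg fun _ _ => (Real.exp_pos _).le) _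
    · simp only []
      obtain ⟨v, hv⟩ := hnet h
      have : Real.exp (l / κ * (θ * Real.sqrt (∑ i, h i ^ 2)))
          ≤ ∑ v, Real.exp (l / κ * ∑ i, y v i * h i) := by
        refine le_trans ?_ (Finset.single_le_sum (fun v _ => (Real.exp_pos _).le) (Finset.mem_univ v))
        apply Real.exp_le_exp.2
        exact mul_le_mul_of_nonneg_left hv (by positivity)
      refine (Real.rpow_le_rpow_of_nonpos (Real.exp_pos _) this (by linarith)).trans (le_of_eq ?_)
      rw [← Real.exp_mul]; congr 1; field_simp
  rw [e1] at h1
  rw [e0] at key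
  set I := ∫ A : M × N → ℝ,
    sPhi (l / κ) (-1) κ (fun q : U × V => ∑ k : M × N, (y q.2 k.1 * x q.1 k.2) * A k) ∂(gpi (M × N))
    with hI
  set W := (Fintype.card V : ℝ) ^ κ with hW
  have hW0 : 0 < W := Real.rpow_pos_of_pos hV _
  have mk : (W⁻¹ * Real.exp (-(l * c))) *
      (gpi (M × N)).real {A | ∃ u, ∀ v, bil A (x u) (y v) ≤ c} ≤ I := by
    refine le_trans ?_ (mul_meas_ge_le_integral_of_nonneg
      (Filter.Eventually.of_forall fun A => ?_) (sPhi_integrable x y (l / κ) (-1) κ)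
      (W⁻¹ * Real.exp (-(l * c))))
    · refine mul_le_mul_of_nonneg_left (measureReal_mono ?_) (by positivity)
      rintro A ⟨u, huv⟩
      simp only [Set.mem_ofPred_eq]
      have : (Fintype.card V * Real.exp (l / κ * c)) ^ (-1:ℝ) ≤ sS (l / κ) (-1)
          (fun q : U × V => ∑ k : M × N, (y q.2 k.1 * x q.1 k.2) * A k) := by
        unfold sS
        refine le_trans ?_ (Finset.single_le_sum
          (fun u _ => Real.rpow_nonneg (sT_pos _ u _).le _) (Finset.mem_univ u))
        refine Real.rpow_le_rpow_of_nonpos (sT_pos _ _ _) ?_ (by norm_num)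
        unfold sT
        calc _ ≤ ∑ _v : V, Real.exp (l / κ * c) := by
              refine Finset.sum_le_sum fun v _ => Real.exp_le_exp.2 ?_
              exact mul_le_mul_of_nonneg_left (huv v) (by positivity)
          _ = _ := by simp
      unfold sPhi
      refine le_trans (le_of_eq ?_) (Real.rpow_le_rpow (by positivity) this hκ.le)
      rw [← Real.rpow_mul (by positivity), Real.mul_rpow hV.le (Real.exp_pos _).le, ← Real.exp_mul,
        neg_one_mul, Real.rpow_neg hV.le]
      congr 2; field_simp
    · exact Real.rpow_nonneg (sS_pos _ _ _).le _
  have e3 : Real.exp (l * c - l ^ 2 / 2) = (Real.exp (l ^ 2 / 2))⁻¹ * (Real.exp (-(l * c)))⁻¹ := by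
    rw [← Real.exp_neg, ← Real.exp_neg, ← Real.exp_add]; congr 1; ring
  set G := ∫ g : N → ℝ, Real.exp (l * Real.sqrt (∑ j, g j ^ 2)) ∂(gpi N)
  set H := ∫ h : M → ℝ, Real.exp (-(l * θ) * Real.sqrt (∑ j, h j ^ 2)) ∂(gpi M)
  set P := (gpi (M × N)).real {A | ∃ u, ∀ v, bil A (x u) (y v) ≤ c}
  have h3 : Real.exp (l ^ 2 / 2) * ((W⁻¹ * Real.exp (-(l * c))) * P) ≤
      ((Fintype.card U : ℝ) ^ κ * G) * H := by
    refine (mul_le_mul_of_nonneg_left mk (Real.exp_pos _).le).trans (key.trans ?_)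
    refine mul_le_mul h1 h2 (integral_nonneg fun h => ?_) (h1.trans' (integral_nonneg fun h => ?_))
    · exact Real.rpow_nonneg (Finset.sum_nonneg fun _ _ => (Real.exp_pos _).le) _
    · exact Real.rpow_nonneg (Finset.sum_nonneg fun _ _ => (Real.exp_pos _).le) _
  rw [e3]
  have p1 := Real.exp_pos (l ^ 2 / 2)
  have p2 := Real.exp_pos (-(l * c))
  calc P = (Real.exp (l ^ 2 / 2))⁻¹ * (Real.exp (-(l * c)))⁻¹ * W *
        (Real.exp (l ^ 2 / 2) * ((W⁻¹ * Real.exp (-(l * c))) * P)) := by field_simp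
    _ ≤ (Real.exp (l ^ 2 / 2))⁻¹ * (Real.exp (-(l * c)))⁻¹ * W *
        (((Fintype.card U : ℝ) ^ κ * G) * H) := by gcongr
    _ = _ := by ring
end tails

section cont
set_option linter.unusedSectionVars false
set_option linter.unusedVariables false

/-- The law of the random matrix. -/
abbrev gmat (m s : ℕ) (σ : ℝ) : Measure (Fin m → Fin s → ℝ) :=
  Measure.pi fun _ : Fin m => Measure.pi fun _ : Fin s => gaussianReal 0 (NNReal.mk (σ ^ 2) (sq_nonneg σ))

/-- Normalization and uncurrying of a matrix. -/
def nrm {m s : ℕ} (σ : ℝ) (A : Fin m → Fin s → ℝ) : Fin m × Fin s → ℝ :=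
  fun k => σ⁻¹ * A k.1 k.2

lemma gmat_map (m s : ℕ) (σ : ℝ) (hσ : 0 < σ) :
    (Measurable (nrm (m := m) (s := s) σ)) ∧
    (gmat m s σ).map (nrm σ) = gpi (Fin m × Fin s) := by
  have hm : Measurable (nrm (m := m) (s := s) σ) := by
    rw [measurable_pi_iff]
    intro k
    unfold nrm
    fun_prop
  refine ⟨hm, ?_⟩
  symm
  refine Measure.pi_eq fun S hS => ?_
  rw [Measure.map_apply hm (MeasurableSet.univ_pi hS)]
  have e : nrm (m := m) (s := s) σ ⁻¹' (Set.univ.pi S)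
      = Set.univ.pi fun i => Set.univ.pi fun j => (fun x : ℝ => σ⁻¹ * x) ⁻¹' S (i, j) := by
    ext A
    simp [nrm, Set.mem_pi]
  rw [e]
  have hp : IsProbabilityMeasure (gaussianReal 0 (NNReal.mk (σ ^ 2) (sq_nonneg σ))) := inferInstance
  have hp2 : IsProbabilityMeasure (Measure.pi fun _ : Fin s =>
    gaussianReal 0 (NNReal.mk (σ ^ 2) (sq_nonneg σ))) := inferInstance
  unfold gmat
  rw [Measure.pi_pi]
  simp only [Measure.pi_pi]
  rw [Fintype.prod_prod_type]
  refine Finset.prod_congr rfl fun i _ => Finset.prod_congr rfl fun j _ => ?_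
  rw [← Measure.map_apply (by fun_prop) (hS _), gaussianReal_map_const_mul, mul_zero]
  congr 2
  ext
  simp only [NNReal.coe_mul, NNReal.coe_mk, NNReal.coe_one]
  field_simp

lemma gmat_le {m s : ℕ} (σ : ℝ) (hσ : 0 < σ) (E : Set (Fin m → Fin s → ℝ))
    (S : Set (Fin m × Fin s → ℝ)) (h : ∀ A ∈ E, nrm σ A ∈ S) :
    gmat m s σ E ≤ gpi (Fin m × Fin s) S := by
  obtain ⟨h1, h2⟩ := gmat_map m s σ hσ
  rw [← h2]
  refine (measure_mono (show E ⊆ nrm σ ⁻¹' S from h)).trans ?_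
  exact Measure.le_map_apply h1.aemeasurable _

lemma bil_nrm {m s : ℕ} (σ : ℝ) (A : Matrix (Fin m) (Fin s) ℝ) (u : EuclideanSpace ℝ (Fin s))
    (v : EuclideanSpace ℝ (Fin m)) :
    bil (nrm σ A) (fun j => u j) (fun i => v i) = σ⁻¹ * inner ℝ v (Matrix.toEuclideanLin A u) := by
  have h1 : ∀ i, (Matrix.toEuclideanLin A u) i = ∑ j, A i j * u j := fun i => rfl
  simp only [bil, nrm, PiLp.inner_apply, h1]
  rw [Fintype.sum_prod_type, Finset.mul_sum]
  refine Finset.sum_congr rfl fun i _ => ?_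
  rw [show ∀ a b : ℝ, inner ℝ a b = a * b from fun a b => by simp [mul_comm]]
  rw [Finset.mul_sum, Finset.mul_sum]
  exact Finset.sum_congr rfl fun j _ => by ring

lemma sphere_sum {n : ℕ} (d : Metric.sphere (0 : EuclideanSpace ℝ (Fin n)) 1) :
    ∑ j, ((d : EuclideanSpace ℝ (Fin n)) j) ^ 2 = 1 := by
  have h := d.2
  rw [mem_sphere_zero_iff_norm] at h
  have h2 := EuclideanSpace.norm_sq_eq (d : EuclideanSpace ℝ (Fin n))
  rw [h] at h2
  simpa using h2.symm

lemma sphere_ne (n : ℕ) (hn : 0 < n) :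
    Nonempty (Metric.sphere (0 : EuclideanSpace ℝ (Fin n)) 1) :=
  ⟨⟨EuclideanSpace.single ⟨0, hn⟩ 1, by simp⟩⟩

theorem upper_sup (m s : ℕ) (hm : 0 < m) (hs : 0 < s) (σ : ℝ) (hσ : 0 < σ) (l c : ℝ) (hl : 0 < l)
    (hc : 0 ≤ c) :
    gmat m s σ {A : Matrix (Fin m) (Fin s) ℝ | ∃ u : EuclideanSpace ℝ (Fin s), ‖u‖ = 1 ∧ σ * c < ‖Matrix.toEuclideanLin A u‖}
      ≤ ENNReal.ofReal (Real.exp (-l * c + l ^ 2 / 2 + l * Real.sqrt s + l * Real.sqrt m)) := by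
  have := sphere_ne m hm
  have := sphere_ne s hs
  set d := TopologicalSpace.denseSeq (Metric.sphere (0 : EuclideanSpace ℝ (Fin s)) 1) with hd
  set e := TopologicalSpace.denseSeq (Metric.sphere (0 : EuclideanSpace ℝ (Fin m)) 1) with he
  set S : ℕ → Set (Fin m × Fin s → ℝ) := fun n => {a | ∃ i j : Fin (n + 1),
    c ≤ bil a (fun t => (d i : EuclideanSpace ℝ (Fin s)) t)
      (fun t => (e j : EuclideanSpace ℝ (Fin m)) t)} with hS
  have hmono : Monotone S := by
    intro n n' hnn a
    rintro ⟨i, j, h⟩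
    exact ⟨⟨i, by omega⟩, ⟨j, by omega⟩, h⟩
  refine (gmat_le σ hσ _ (⋃ n, S n) ?_).trans ?_
  · rintro A ⟨u, hu, hcu⟩
    set w := Matrix.toEuclideanLin A u with hw
    have hw0 : 0 < ‖w‖ := lt_of_le_of_lt (by positivity) hcu
    have hdd : DenseRange (Prod.map d e) :=
      (TopologicalSpace.denseRange_denseSeq _).prodMap (TopologicalSpace.denseRange_denseSeq _)
    have hcont : Continuous (fun p : Metric.sphere (0 : EuclideanSpace ℝ (Fin s)) 1 ×
        Metric.sphere (0 : EuclideanSpace ℝ (Fin m)) 1 =>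
        inner ℝ (p.2 : EuclideanSpace ℝ (Fin m))
          (Matrix.toEuclideanLin A (p.1 : EuclideanSpace ℝ (Fin s)))) := by
      have : Continuous (Matrix.toEuclideanLin A) := LinearMap.continuous_of_finiteDimensional _
      fun_prop
    obtain ⟨⟨i, j⟩, hij⟩ := hdd.exists_mem_open (isOpen_lt (continuous_const (y := σ * c)) hcont)
      ⟨(⟨u, by simp [hu]⟩, ⟨‖w‖⁻¹ • w, by simp [norm_smul, hw0.ne']⟩), by
        simp only [Set.mem_ofPred_eq]
        rw [inner_smul_left, real_inner_self_eq_norm_sq]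
        simp only [conj_trivial]
        calc σ * c < ‖w‖ := hcu
          _ = _ := by field_simp⟩
    simp only [Set.mem_ofPred_eq, Prod.map] at hij
    refine Set.mem_iUnion.2 ⟨max i j, ⟨i, by omega⟩, ⟨j, by omega⟩, ?_⟩
    refine le_trans ?_ (bil_nrm σ A (d i) (e j)).ge
    rw [le_inv_mul_iff₀ hσ]
    exact hij.le
  · rw [hmono.measure_iUnion]
    refine iSup_le fun n => ?_
    rw [← ofReal_measureReal]
    apply ENNReal.ofReal_le_ofReal
    refine (upper_fin (M := Fin m) (N := Fin s) (fun i : Fin (n + 1) => fun t => (d i : EuclideanSpace ℝ (Fin s)) t)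
      (fun j : Fin (n + 1) => fun t => (e j : EuclideanSpace ℝ (Fin m)) t)
      (fun i => sphere_sum _) (fun j => sphere_sum _) l c hl).trans ?_
    have h1 := chi_upper (N := Fin s) (by simpa using hs) l hl.le
    have h2 := chi_upper (N := Fin m) (by simpa using hm) l hl.le
    rw [Fintype.card_fin] at h1 h2
    calc _ ≤ Real.exp (-l * c - l ^ 2 / 2) * (Real.exp (l * Real.sqrt s + l ^ 2 / 2) *
          Real.exp (l * Real.sqrt m + l ^ 2 / 2)) := by
          refine mul_le_mul_of_nonneg_left ?_ (Real.exp_pos _).le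
          exact mul_le_mul h1 h2 (integral_nonneg fun _ => (Real.exp_pos _).le) (Real.exp_pos _).le
      _ = _ := by
          rw [← Real.exp_add, ← Real.exp_add]; congr 1; ring

theorem lower_inf_eps (m s : ℕ) (hm : 2 ≤ m) (hs : 0 < s) (σ : ℝ) (hσ : 0 < σ) (l c ε : ℝ)
    (hl : 0 < l) (hε : 0 < ε) (hε1 : ε ≤ 1) :
    gmat m s σ {A : Matrix (Fin m) (Fin s) ℝ | ∃ u : EuclideanSpace ℝ (Fin s), ‖u‖ = 1 ∧ ‖Matrix.toEuclideanLin A u‖ < σ * c}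
      ≤ ENNReal.ofReal (Real.exp (l * c + l * Real.sqrt s
        - l * (1 - ε) * Real.sqrt ((m : ℝ) - 1) + l ^ 2 / 2)) := by
  have hm0 : 0 < m := by omega
  have := sphere_ne m hm0
  have := sphere_ne s hs
  set d := TopologicalSpace.denseSeq (Metric.sphere (0 : EuclideanSpace ℝ (Fin s)) 1) with hd
  obtain ⟨T, hTs, hTf, hT⟩ := (isCompact_sphere (0 : EuclideanSpace ℝ (Fin m)) 1).finite_cover_balls hε
  have : Fintype T := hTf.fintype
  have hTne : Nonempty T := by
    obtain ⟨z⟩ := sphere_ne m hm0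
    have := hT z.2
    simp only [Set.mem_iUnion] at this
    obtain ⟨t, ht, _⟩ := this
    exact ⟨⟨t, ht⟩⟩
  classical
  have hnet : ∀ h : Fin m → ℝ, ∃ v : T, (1 - ε) * Real.sqrt (∑ i, h i ^ 2)
      ≤ ∑ i, (v : EuclideanSpace ℝ (Fin m)) i * h i := by
    intro h
    set w : EuclideanSpace ℝ (Fin m) := WithLp.toLp 2 h with hw
    have hwn : Real.sqrt (∑ i, h i ^ 2) = ‖w‖ := by
      rw [EuclideanSpace.norm_eq]; simp [hw]
    have hin : ∀ v : EuclideanSpace ℝ (Fin m), ∑ i, v i * h i = inner ℝ v w := by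
      intro v
      simp [PiLp.inner_apply, hw, mul_comm]
    rw [hwn]
    simp only [hin]
    by_cases h0 : ‖w‖ = 0
    · obtain ⟨t⟩ := hTne
      refine ⟨t, ?_⟩
      rw [norm_eq_zero] at h0
      rw [h0]; simp
    · have hw0 : 0 < ‖w‖ := lt_of_le_of_ne (norm_nonneg _) (Ne.symm h0)
      have hmem : ‖w‖⁻¹ • w ∈ Metric.sphere (0 : EuclideanSpace ℝ (Fin m)) 1 := by
        simp [norm_smul, h0]
      have := hT hmem
      simp only [Set.mem_iUnion] at this
      obtain ⟨t, ht, htb⟩ := this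
      refine ⟨⟨t, ht⟩, ?_⟩
      rw [Metric.mem_ball, dist_eq_norm] at htb
      have e1 : inner ℝ t w = ‖w‖ - inner ℝ (‖w‖⁻¹ • w - t) w := by
        rw [inner_sub_left, inner_smul_left, real_inner_self_eq_norm_sq]
        simp only [conj_trivial]
        field_simp
        ring
      have e2 := real_inner_le_norm (‖w‖⁻¹ • w - t) w
      rw [e1]
      nlinarith
  set S : ℕ → Set (Fin m × Fin s → ℝ) := fun n => {a | ∃ i : Fin (n + 1), ∀ j : T,
    bil a (fun t => (d i : EuclideanSpace ℝ (Fin s)) t)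
      (fun t => (j : EuclideanSpace ℝ (Fin m)) t) ≤ c} with hS
  have hmono : Monotone S := by
    intro n n' hnn a
    rintro ⟨i, h⟩
    exact ⟨⟨i, by omega⟩, h⟩
  have hTn : ∀ j : T, ‖(j : EuclideanSpace ℝ (Fin m))‖ = 1 := fun j =>
    mem_sphere_zero_iff_norm.1 (hTs j.2)
  refine (gmat_le σ hσ _ (⋃ n, S n) ?_).trans ?_
  · rintro A ⟨u, hu, hcu⟩
    have hcont : Continuous (fun p : Metric.sphere (0 : EuclideanSpace ℝ (Fin s)) 1 =>
        ‖Matrix.toEuclideanLin A (p : EuclideanSpace ℝ (Fin s))‖) := by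
      have : Continuous (Matrix.toEuclideanLin A) := LinearMap.continuous_of_finiteDimensional _
      fun_prop
    obtain ⟨i, hi⟩ := (TopologicalSpace.denseRange_denseSeq _).exists_mem_open
      (isOpen_lt hcont (continuous_const (y := σ * c))) ⟨⟨u, by simp [hu]⟩, hcu⟩
    simp only [Set.mem_ofPred_eq] at hi
    refine Set.mem_iUnion.2 ⟨i, ⟨i, by omega⟩, fun j => ?_⟩
    refine (bil_nrm σ A (d i) j).le.trans ?_
    rw [inv_mul_le_iff₀ hσ]
    refine le_trans ?_ hi.le
    refine (real_inner_le_norm _ _).trans ?_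
    rw [hTn j, one_mul]
  · rw [hmono.measure_iUnion]
    refine iSup_le fun n => ?_
    rw [← ofReal_measureReal]
    apply ENNReal.ofReal_le_ofReal
    refine (lower_fin (M := Fin m) (N := Fin s) (fun i : Fin (n + 1) => fun t => (d i : EuclideanSpace ℝ (Fin s)) t)
      (fun j : T => fun t => (j : EuclideanSpace ℝ (Fin m)) t)
      (fun i => sphere_sum _) (fun j => sphere_sum ⟨j, hTs j.2⟩) l c (1 - ε) hl hnet).trans ?_
    have h1 := chi_upper (N := Fin s) (by simpa using hs) l hl.le
    have h2 := chi_lower (N := Fin m) (l * (1 - ε)) (mul_nonneg hl.le (by linarith)) (by simpa using hm)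
    rw [Fintype.card_fin] at h1 h2
    calc _ ≤ Real.exp (l * c - l ^ 2 / 2) * (Real.exp (l * Real.sqrt s + l ^ 2 / 2) *
          Real.exp (-(l * (1 - ε)) * Real.sqrt ((m : ℝ) - 1) + (l * (1 - ε)) ^ 2 / 4)) := by
          refine mul_le_mul_of_nonneg_left ?_ (Real.exp_pos _).le
          exact mul_le_mul h1 h2 (integral_nonneg fun _ => (Real.exp_pos _).le) (Real.exp_pos _).le
      _ ≤ _ := by
          rw [← Real.exp_add, ← Real.exp_add]
          apply Real.exp_le_exp.2
          have h3 : (l * (1 - ε)) ^ 2 ≤ l ^ 2 := by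
            apply pow_le_pow_left₀ (mul_nonneg hl.le (by linarith))
            nlinarith
          nlinarith [sq_nonneg l]
end cont

section fin
set_option linter.unusedVariables false

lemma sval_exists_unit {m s : ℕ} (A : Matrix (Fin m) (Fin s) ℝ) (t : ℝ)
    (S : Submodule ℝ (EuclideanSpace ℝ (Fin s))) (hS : 0 < Module.finrank ℝ S)
    (h : ∀ x ∈ S, t * ‖x‖ ≤ ‖Matrix.toEuclideanLin A x‖) :
    ∃ u : EuclideanSpace ℝ (Fin s), ‖u‖ = 1 ∧ t ≤ ‖Matrix.toEuclideanLin A u‖ := by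
  have : Nontrivial S := Module.nontrivial_of_finrank_pos hS
  obtain ⟨x, hx⟩ := exists_ne (0 : S)
  have hx0 : (x : EuclideanSpace ℝ (Fin s)) ≠ 0 := by simpa using hx
  have hn : ‖(x : EuclideanSpace ℝ (Fin s))‖ ≠ 0 := norm_ne_zero_iff.2 hx0
  have hu : ‖(‖(x : EuclideanSpace ℝ (Fin s))‖⁻¹ • (x : EuclideanSpace ℝ (Fin s)))‖ = 1 := by
    rw [norm_smul, norm_inv, norm_norm, inv_mul_cancel₀ hn]
  refine ⟨_, hu, ?_⟩
  have := h _ (S.smul_mem (‖(x : EuclideanSpace ℝ (Fin s))‖⁻¹) x.2)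
  rwa [hu, mul_one] at this

lemma sval_one_exists {m s : ℕ} (A : Matrix (Fin m) (Fin s) ℝ) (c : ℝ) (hc : 0 ≤ c)
    (h : c < sval A 1) :
    ∃ u : EuclideanSpace ℝ (Fin s), ‖u‖ = 1 ∧ c < ‖Matrix.toEuclideanLin A u‖ := by
  unfold sval at h
  have hne : { t : ℝ | 0 ≤ t ∧ ∃ S : Submodule ℝ (EuclideanSpace ℝ (Fin s)),
    Module.finrank ℝ S = 1 ∧ ∀ x ∈ S, t * ‖x‖ ≤ ‖Matrix.toEuclideanLin A x‖ }.Nonempty := by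
    by_contra hn
    rw [Set.not_nonempty_iff_eq_empty] at hn
    rw [hn, Real.sSup_empty] at h
    linarith
  obtain ⟨t, ⟨_, S, hS, ht⟩, hct⟩ := exists_lt_of_lt_csSup hne h
  obtain ⟨u, hu, hu2⟩ := sval_exists_unit A t S (by omega) ht
  exact ⟨u, hu, hct.trans_le hu2⟩

lemma sval_nonneg {m s : ℕ} (A : Matrix (Fin m) (Fin s) ℝ) (i : ℕ) : 0 ≤ sval A i :=
  Real.sSup_nonneg fun t ht => ht.1

lemma sval_last_exists {m s : ℕ} (hs : 0 < s) (A : Matrix (Fin m) (Fin s) ℝ) (c : ℝ)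
    (h : sval A s < c) :
    ∃ u : EuclideanSpace ℝ (Fin s), ‖u‖ = 1 ∧ ‖Matrix.toEuclideanLin A u‖ < c := by
  by_contra! hcon
  have hc : 0 ≤ c := (sval_nonneg A s).trans h.le
  refine absurd h (not_lt.2 (le_csSup ?_ ⟨hc, ⊤, by simp, ?_⟩))
  · refine ⟨‖LinearMap.toContinuousLinearMap (Matrix.toEuclideanLin A)‖, ?_⟩
    rintro t ⟨_, S, hS, ht⟩
    obtain ⟨u, hu, hu2⟩ := sval_exists_unit A t S (by omega) ht
    refine hu2.trans ?_
    have := (LinearMap.toContinuousLinearMap (Matrix.toEuclideanLin A)).le_opNorm u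
    rw [hu, mul_one] at this
    exact this
  · intro x _
    by_cases hx : x = 0
    · simp [hx]
    have hn : 0 < ‖x‖ := norm_pos_iff.2 hx
    have hu : ‖(‖x‖⁻¹ • x)‖ = 1 := by
      rw [norm_smul, norm_inv, norm_norm, inv_mul_cancel₀ hn.ne']
    have := hcon _ hu
    rw [map_smul, norm_smul, norm_inv, norm_norm, inv_mul_eq_div, le_div_iff₀ hn] at this
    exact this

theorem event_one (m s : ℕ) (hm : 0 < m) (hs : 0 < s) (σ : ℝ) (hσ : 0 < σ) (l X : ℝ) (hl : 0 < l)
    (hX : 0 < X) :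
    gmat m s σ {A : Matrix (Fin m) (Fin s) ℝ | σ * X ≤ sval A 1}
      ≤ ENNReal.ofReal (Real.exp (-l * X + l ^ 2 / 2 + l * Real.sqrt s + l * Real.sqrt m)) := by
  have ht : Filter.Tendsto (fun δ : ℝ => ENNReal.ofReal (Real.exp (-l * (X - δ) + l ^ 2 / 2
      + l * Real.sqrt s + l * Real.sqrt m))) (nhdsWithin 0 (Set.Ioi 0))
      (nhds (ENNReal.ofReal (Real.exp (-l * (X - 0) + l ^ 2 / 2
      + l * Real.sqrt s + l * Real.sqrt m)))) := by
    apply Filter.Tendsto.mono_left _ nhdsWithin_le_nhds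
    have : Continuous (fun δ : ℝ => ENNReal.ofReal (Real.exp (-l * (X - δ) + l ^ 2 / 2
      + l * Real.sqrt s + l * Real.sqrt m))) := ENNReal.continuous_ofReal.comp (by fun_prop)
    exact this.tendsto 0
  rw [sub_zero] at ht
  refine ge_of_tendsto ht ?_
  filter_upwards [Ioc_mem_nhdsGT hX] with δ hδ
  refine le_trans (measure_mono ?_) (upper_sup m s hm hs σ hσ l (X - δ) hl (by linarith [hδ.2]))
  intro A hA
  refine sval_one_exists A _ (mul_nonneg hσ.le (by linarith [hδ.2])) (lt_of_lt_of_le ?_ hA)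
  have := hδ.1
  nlinarith

theorem event_two (m s : ℕ) (hm : 2 ≤ m) (hs : 0 < s) (σ : ℝ) (hσ : 0 < σ) (l x : ℝ) (hl : 0 < l) :
    gmat m s σ {A : Matrix (Fin m) (Fin s) ℝ | sval A s ≤ σ * x}
      ≤ ENNReal.ofReal (Real.exp (l * x + l * Real.sqrt s
        - l * Real.sqrt ((m : ℝ) - 1) + l ^ 2 / 2)) := by
  have ht : Filter.Tendsto (fun δ : ℝ => ENNReal.ofReal (Real.exp (l * (x + δ) + l * Real.sqrt s
        - l * (1 - δ) * Real.sqrt ((m : ℝ) - 1) + l ^ 2 / 2))) (nhdsWithin 0 (Set.Ioi 0))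
      (nhds (ENNReal.ofReal (Real.exp (l * (x + 0) + l * Real.sqrt s
        - l * (1 - 0) * Real.sqrt ((m : ℝ) - 1) + l ^ 2 / 2)))) := by
    apply Filter.Tendsto.mono_left _ nhdsWithin_le_nhds
    have : Continuous (fun δ : ℝ => ENNReal.ofReal (Real.exp (l * (x + δ) + l * Real.sqrt s
        - l * (1 - δ) * Real.sqrt ((m : ℝ) - 1) + l ^ 2 / 2))) :=
      ENNReal.continuous_ofReal.comp (by fun_prop)
    exact this.tendsto 0
  rw [add_zero, sub_zero, mul_one] at ht
  refine ge_of_tendsto ht ?_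
  filter_upwards [Ioc_mem_nhdsGT (zero_lt_one' ℝ)] with δ hδ
  refine le_trans (measure_mono ?_) (lower_inf_eps m s hm hs σ hσ l (x + δ) δ hl hδ.1 hδ.2)
  intro A hA
  refine sval_last_exists hs A _ (lt_of_le_of_lt hA ?_)
  have := hδ.1
  nlinarith

lemma sqrt_pair (g : ℝ) (h0 : 0 ≤ g) (h1 : g ≤ 1) :
    Real.sqrt (1 + g) + Real.sqrt (1 - g) ≤ 2 - g ^ 2 / 4 := by
  set a := Real.sqrt (1 + g) with ha
  set b := Real.sqrt (1 - g) with hb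
  have ha2 : a ^ 2 = 1 + g := Real.sq_sqrt (by linarith)
  have hb2 : b ^ 2 = 1 - g := Real.sq_sqrt (by linarith)
  have ha0 : 0 ≤ a := Real.sqrt_nonneg _
  have hb0 : 0 ≤ b := Real.sqrt_nonneg _
  have hab : a * b ≤ 1 - g ^ 2 / 2 := by
    apply abs_le_of_sq_le_sq' _ (by nlinarith) |>.2
    have : (a * b) ^ 2 = 1 - g ^ 2 := by rw [mul_pow, ha2, hb2]; ring
    nlinarith [sq_nonneg (g ^ 2)]
  apply abs_le_of_sq_le_sq' _ (by nlinarith) |>.2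
  nlinarith [sq_nonneg (g ^ 2)]
end fin


/-- Two-sided tail bound for the extreme singular values of
an i.i.d. Gaussian matrix. -/
theorem statement16 (s m : ℕ) (hs : 0 < s) (hsm : s ≤ m) (σ : ℝ) (hσ : 0 < σ)
    (g : ℝ) (hg1 : (s : ℝ) / m + 2 * Real.sqrt ((s : ℝ) / m) < g) (hg2 : g ≤ 1) :
    (Measure.pi fun _ : Fin m => Measure.pi fun _ : Fin s =>
        gaussianReal 0 ⟨σ ^ 2, sq_nonneg σ⟩)
      {A : Matrix (Fin m) (Fin s) ℝ |
        g ≤ max (sval A 1 ^ 2 / (m * σ ^ 2) - 1)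
              (1 - sval A s ^ 2 / (m * σ ^ 2))} ≤
      ENNReal.ofReal (2 * Real.exp (-(m : ℝ) / 2 *
        (Real.sqrt (1 + g) - 1 - Real.sqrt ((s : ℝ) / m)) ^ 2)) := by
  have hm0 : 0 < m := by omega
  have hmR : (0:ℝ) < m := by exact_mod_cast hm0
  have hs1 : (1:ℝ) ≤ s := by exact_mod_cast hs
  set r := Real.sqrt ((s : ℝ) / m) with hr
  have hr0 : 0 ≤ r := Real.sqrt_nonneg _
  have hr2 : r ^ 2 = (s : ℝ) / m := Real.sq_sqrt (by positivity)
  rw [← hr2] at hg1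
  have hg0 : 0 < g := by nlinarith
  have hm2 : 2 ≤ m := by
    by_contra hcon
    have h1 : m = 1 := by omega
    have h2 : s = 1 := by omega
    have : r ^ 2 = 1 := by rw [hr2, h1, h2]; norm_num
    nlinarith
  set p := Real.sqrt (m : ℝ) with hp
  have hp0 : 0 < p := Real.sqrt_pos.2 hmR
  have hp2 : p ^ 2 = m := Real.sq_sqrt hmR.le
  have hsq : Real.sqrt (s : ℝ) = p * r := by
    rw [hp, hr, ← Real.sqrt_mul hmR.le]; congr 1; field_simp
  set a := Real.sqrt (1 + g) with ha
  set b := Real.sqrt (1 - g) with hb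
  have ha2 : a ^ 2 = 1 + g := Real.sq_sqrt (by linarith)
  have hb2 : b ^ 2 = 1 - g := Real.sq_sqrt (by linarith)
  have hb0 : 0 ≤ b := Real.sqrt_nonneg _
  have hal : 1 + r < a := by
    apply Real.lt_sqrt_of_sq_lt
    nlinarith
  set t := a - 1 - r with ht
  have ht0 : 0 < t := by rw [ht]; linarith
  set l := p * t with hl
  have hl0 : 0 < l := mul_pos hp0 ht0
  have E1 := event_one m s hm0 hs σ hσ l (p * a) hl0 (mul_pos hp0 (by linarith))
  have E2 := event_two m s hm2 hs σ hσ l (p * b) hl0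
  rw [hsq] at E1 E2
  have hexp : -(m : ℝ) / 2 * t ^ 2 = -(l ^ 2 / 2) := by rw [hl, ← hp2]; ring
  have x1 : -l * (p * a) + l ^ 2 / 2 + l * (p * r) + l * p = -(m : ℝ) / 2 * t ^ 2 := by
    rw [hexp]
    have : a = t + 1 + r := by rw [ht]; ring
    rw [this, hl]; ring
  have hq : p * (a + b - 1) ≤ Real.sqrt ((m : ℝ) - 1) := by
    have h1 := sqrt_pair g hg0.le hg2
    have hm2R : (2:ℝ) ≤ m := by exact_mod_cast hm2
    have h2 : 1 / (m : ℝ) ≤ g ^ 2 / 4 := by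
      have : 1 / (m : ℝ) ≤ r ^ 2 := by rw [hr2]; gcongr
      nlinarith
    have h3 : p * (a + b - 1) ≤ p * (1 - 1 / m) := by
      apply mul_le_mul_of_nonneg_left _ hp0.le
      linarith
    refine h3.trans (Real.le_sqrt_of_sq_le ?_)
    rw [mul_pow, hp2]
    have : (m : ℝ) * (1 - 1 / m) ^ 2 = (m - 1) - (1 - 1 / m) := by field_simp
    rw [this]
    have : 1 / (m : ℝ) ≤ 1 := by rw [div_le_one hmR]; linarith
    linarith
  have x2 : l * (p * b) + l * (p * r) - l * Real.sqrt ((m : ℝ) - 1) + l ^ 2 / 2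
      ≤ -(m : ℝ) / 2 * t ^ 2 := by
    rw [hexp]
    have h4 : p * b + p * r + l ≤ Real.sqrt ((m : ℝ) - 1) := by
      refine le_trans (le_of_eq ?_) hq
      rw [hl, ht]; ring
    nlinarith
  rw [x1] at E1
  replace E2 := E2.trans (ENNReal.ofReal_le_ofReal (Real.exp_le_exp.2 x2))
  rw [two_mul, ENNReal.ofReal_add (Real.exp_pos _).le (Real.exp_pos _).le]
  refine le_trans ?_ (add_le_add E1 E2)
  change gmat m s σ _ ≤ _
  refine le_trans (measure_mono ?_) (measure_union_le _ _)
  intro A hA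
  have hA' : g ≤ max (sval A 1 ^ 2 / (m * σ ^ 2) - 1) (1 - sval A s ^ 2 / (m * σ ^ 2)) := hA
  have hD : 0 < (m : ℝ) * σ ^ 2 := by positivity
  rcases le_max_iff.1 hA' with h | h
  · left
    change σ * (p * a) ≤ sval A 1
    have h1 : (1 + g) * (m * σ ^ 2) ≤ sval A 1 ^ 2 := by
      rw [← le_div_iff₀ hD]; linarith
    apply abs_le_of_sq_le_sq' _ (sval_nonneg A 1) |>.2
    calc (σ * (p * a)) ^ 2 = (1 + g) * (m * σ ^ 2) := by rw [← ha2, ← hp2]; ring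
      _ ≤ _ := h1
  · right
    change sval A s ≤ σ * (p * b)
    have h1 : sval A s ^ 2 ≤ (1 - g) * (m * σ ^ 2) := by
      rw [← div_le_iff₀ hD]; linarith
    apply abs_le_of_sq_le_sq' _ (by positivity) |>.2
    calc _ ≤ (1 - g) * (m * σ ^ 2) := h1
      _ = _ := by rw [← hb2, ← hp2]; ring

end
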